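/- arXiv:1203.6693 — 8 statements merged into one kernel-verified Lean document; each statement's English description precedes it below -/
import Mathlib

section
/- Let 𝒱 be a linear subspace of M′ that is dense in M′ in the strong operator topology. Then 𝒱ξ is a common core for all operators in Op‡_M(Ξ): for every linear operator T in H with domain Ξ satisfying u*Tu = T for all unitaries u ∈ M′ (in particular u(Ξ) = Ξ) and satisfying Ξ ⊆ Dom T*, the operator T is closable and the closure of the restriction of T to 𝒱ξ equals the closure of T. -/
/-!
STATEMENT 1.  Let `M` be a von Neumann algebra on a complex Hilbert space `H` with cyclic and
separating vector `ξ`, let `Ξ := M′ξ`, and let `𝒱` be a linear subspace of `M′` which is dense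
in `M′` in the strong operator topology.  Then `𝒱ξ` is a common core for all operators in
`Op‡_M(Ξ)`: every operator `T` with domain `Ξ` satisfying `u* T u = T` for all unitaries
`u ∈ M′` and `Ξ ⊆ Dom T*` is closable, and the closure of its restriction to `𝒱ξ` equals its
closure.
-/

/-- Evaluation at a vector, as a linear map on bounded operators. -/
noncomputable def evalAt {H : Type*} [NormedAddCommGroup H] [InnerProductSpace ℂ H]
    (ξ : H) : (H →L[ℂ] H) →ₗ[ℂ] H where
  toFun v := v ξ
  map_add' := by intros; simp
  map_smul' := by intros; simp

namespace VonNeumannAlgebra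

variable {H : Type*} [NormedAddCommGroup H] [InnerProductSpace ℂ H] [CompleteSpace H]

theorem isClosed_coe (N : VonNeumannAlgebra H) : IsClosed (N : Set (H →L[ℂ] H)) := by
  rw [← N.centralizer_centralizer]
  exact Set.isClosed_centralizer _

/-- A von Neumann algebra is spanned by its unitary elements. -/
theorem mem_span_unitary (N : VonNeumannAlgebra H) {a : H →L[ℂ] H} (ha : a ∈ N) :
    a ∈ Submodule.span ℂ {u | u ∈ N ∧ u * star u = 1 ∧ star u * u = 1} := by
  have : IsClosed (N.toStarSubalgebra : Set (H →L[ℂ] H)) := N.isClosed_coe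
  have hspan : (⟨a, ha⟩ : N.toStarSubalgebra) ∈
      Submodule.span ℂ (unitary N.toStarSubalgebra : Set N.toStarSubalgebra) := by
    rw [CStarAlgebra.span_unitary]
    trivial
  have hmap := Submodule.mem_map_of_mem (f := N.toStarSubalgebra.subtype.toLinearMap) hspan
  rw [Submodule.map_span] at hmap
  refine Submodule.span_mono ?_ hmap
  rintro _ ⟨u, hu, rfl⟩
  exact ⟨u.2, congrArg Subtype.val (Unitary.mul_star_self_of_mem hu),
    congrArg Subtype.val (Unitary.star_mul_self_of_mem hu)⟩

/-- A vector that is separating for a von Neumann algebra is cyclic for its commutant. -/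
theorem dense_map_evalAt_commutant (M : VonNeumannAlgebra H) {ξ : H}
    (hξ : ∀ x ∈ M, x ξ = 0 → x = 0) :
    Dense (Submodule.map (evalAt ξ)
      (Subalgebra.toSubmodule M.commutant.toSubalgebra) : Set H) := by
  set Ξ := Submodule.map (evalAt ξ) (Subalgebra.toSubmodule M.commutant.toSubalgebra)
  have hinv : ∀ y ∈ M.commutant, Ξᗮ ∈ Module.End.invtSubmodule y := by
    intro y hy z hz
    rw [Submodule.mem_comap, Submodule.mem_orthogonal]
    rintro _ ⟨b, hb, rfl⟩
    have := (Submodule.mem_orthogonal _ _).1 hz (evalAt ξ (star y * b))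
      ⟨_, M.commutant.mul_mem' (star_mem hy) hb, rfl⟩
    simpa [evalAt, ContinuousLinearMap.star_eq_adjoint,
      ContinuousLinearMap.adjoint_inner_left] using this
  have hmem : Ξᗮ.starProjection ∈ M := by
    rw [IsStarProjection.mem_iff isStarProjection_starProjection]
    simpa using hinv
  have hξΞ : ξ ∈ Ξ := ⟨1, M.commutant.one_mem', by simp [evalAt]⟩
  have hzero := hξ _ hmem (Submodule.starProjection_orthogonal_apply_eq_zero hξΞ)
  rw [Submodule.dense_iff_topologicalClosure_eq_top,
    Submodule.topologicalClosure_eq_top_iff]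
  rw [← Submodule.range_starProjection Ξᗮ, hzero]
  simp

end VonNeumannAlgebra

namespace LinearPMap

variable {𝕜 E F : Type*} [RCLike 𝕜] [NormedAddCommGroup E] [InnerProductSpace 𝕜 E]
  [NormedAddCommGroup F] [InnerProductSpace 𝕜 F] [CompleteSpace E] [CompleteSpace F]

/-- A densely defined operator with densely defined adjoint is closable. -/
theorem isClosable_of_dense_adjoint_domain {T : E →ₗ.[𝕜] F} (hT : Dense (T.domain : Set E))
    (hT' : Dense (T.adjoint.domain : Set F)) : T.IsClosable :=
  (adjoint_isClosed hT').isClosable.leIsClosable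
    ((adjoint_isFormalAdjoint hT).le_adjoint hT')

end LinearPMap

theorem stmt1 {H : Type*} [NormedAddCommGroup H] [InnerProductSpace ℂ H] [CompleteSpace H]
    (M : VonNeumannAlgebra H) (ξ : H)
    -- `ξ` is cyclic for `M`:
    (hcyclic : Dense {y : H | ∃ x ∈ M, x ξ = y})
    -- `ξ` is separating for `M`:
    (hseparating : ∀ x ∈ M, x ξ = 0 → x = 0)
    -- `𝒱`, a subspace of the commutant, strong-operator-topology dense in it:
    (𝒱 : Submodule ℂ (H →L[ℂ] H)) (h𝒱 : ∀ v ∈ 𝒱, v ∈ M.commutant)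
    (h𝒱dense : ∀ a ∈ M.commutant, ∀ ε > (0:ℝ), ∀ s : Finset H,
      ∃ v ∈ 𝒱, ∀ y ∈ s, ‖(a - v) y‖ < ε)
    -- `T`, an operator with domain `Ξ := M′ξ` ...
    (T : H →ₗ.[ℂ] H)
    (hdom : T.domain =
      Submodule.map (evalAt ξ) (Subalgebra.toSubmodule M.commutant.toSubalgebra))
    -- ... affiliated to `M`, i.e. `u* T u = T` for every unitary `u ∈ M′` ...
    (haff : ∀ u : H →L[ℂ] H, u ∈ M.commutant → u * star u = 1 → star u * u = 1 →
      (∀ z : H, u z ∈ T.domain ↔ z ∈ T.domain) ∧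
      (∀ (z : H) (hz : z ∈ T.domain) (hz' : u z ∈ T.domain),
        (star u) (T ⟨u z, hz'⟩) = T ⟨z, hz⟩))
    -- ... with `Ξ ⊆ Dom T*`:
    (hadj : T.domain ≤ T.adjoint.domain) :
    T.IsClosable ∧ (T.domRestrict (Submodule.map (evalAt ξ) 𝒱)).closure = T.closure := by
  have hmem : ∀ a ∈ M.commutant, a ξ ∈ T.domain := fun a ha => hdom ▸ ⟨a, ha, rfl⟩
  have hdense : Dense (T.domain : Set H) := hdom ▸ M.dense_map_evalAt_commutant hseparating
  have hclosable : T.IsClosable :=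
    LinearPMap.isClosable_of_dense_adjoint_domain hdense (hdense.mono hadj)
  have hξ : ξ ∈ T.domain := by simpa using hmem 1 (one_mem _)
  have hgraph : ∀ a ∈ M.commutant, (a ξ, a (T ⟨ξ, hξ⟩)) ∈ T.graph := by
    intro a ha
    refine (Submodule.span_le (p := T.graph.comap
      ((evalAt ξ).prod (evalAt (T ⟨ξ, hξ⟩))))).2 ?_ (M.commutant.mem_span_unitary ha)
    rintro u ⟨hu, huu, huu'⟩
    change (u ξ, u (T ⟨ξ, hξ⟩)) ∈ T.graph
    have h := (haff u hu huu huu').2 ξ hξ (hmem u hu)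
    rw [← h, ← mul_apply_eq_comp, huu]
    exact T.mem_graph ⟨u ξ, hmem u hu⟩
  refine ⟨hclosable, ?_⟩
  have hle : T.domRestrict (Submodule.map (evalAt ξ) 𝒱) ≤ T := LinearPMap.domRestrict_le
  refine LinearPMap.eq_of_eq_graph ?_
  rw [← hclosable.graph_closure_eq_closure_graph,
    ← (hclosable.leIsClosable hle).graph_closure_eq_closure_graph]
  refine le_antisymm (Submodule.topologicalClosure_mono (LinearPMap.le_graph_of_le hle))
    (Submodule.topologicalClosure_minimal _ ?_ (Submodule.isClosed_topologicalClosure _))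
  rintro ⟨x, y⟩ hxy
  obtain ⟨a, ha, rfl⟩ : ∃ a ∈ M.commutant, a ξ = x := by
    have := LinearPMap.mem_domain_of_mem_graph hxy
    rw [hdom] at this
    exact this
  obtain rfl : y = a (T ⟨ξ, hξ⟩) := LinearPMap.mem_graph_snd_inj T hxy (hgraph a ha) rfl
  rw [← SetLike.mem_coe, Submodule.topologicalClosure_coe, Metric.mem_closure_iff]
  intro ε hε
  classical
  obtain ⟨v, hv, hvε⟩ := h𝒱dense a ha ε hε {ξ, T ⟨ξ, hξ⟩}
  refine ⟨(v ξ, v (T ⟨ξ, hξ⟩)), ?_, ?_⟩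
  · obtain ⟨z, hz, hz'⟩ := (LinearPMap.mem_graph_iff T).1 (hgraph v (h𝒱 v hv))
    have hd : v ξ ∈ (T.domRestrict (Submodule.map (evalAt ξ) 𝒱)).domain :=
      ⟨⟨v, hv, rfl⟩, hmem v (h𝒱 v hv)⟩
    refine (LinearPMap.mem_graph_iff _).2 ⟨⟨v ξ, hd⟩, rfl, ?_⟩
    exact (LinearPMap.domRestrict_apply (x := ⟨v ξ, hd⟩) (y := z) hz.symm).trans hz'
  · rw [Prod.dist_eq, max_lt_iff, dist_eq_norm, dist_eq_norm]
    exact ⟨by simpa using hvε ξ (by simp), by simpa using hvε (T ⟨ξ, hξ⟩) (by simp)⟩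
end

section
/- Let 𝔥 be a complex Hilbert space and let H₁ be a closed real-linear subspace of 𝔥 satisfying H₁ ∩ iH₁ = {0} and H₁ + iH₁ = 𝔥. Then the map s : 𝔥 → 𝔥 defined by s(ζ + iη) = −ζ + iη for ζ, η ∈ H₁ is well defined, conjugate-linear, bounded, and satisfies s² = I (in particular, s(ζ) = −ζ for ζ ∈ H₁ and s(iζ) = iζ for ζ ∈ H₁). -/
open Complex in
/-- In a complex vector space, the decomposition `ζ + iη` with `ζ, η` in a real subspace `H`
satisfying `H ∩ iH = {0}` is unique. -/
lemma Submodule.eq_and_eq_of_add_I_smul_eq {E : Type*} [AddCommGroup E] [Module ℂ E]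
    (H : Submodule ℝ E) (hcap : ∀ x ∈ H, ∀ y ∈ H, x = I • y → x = 0) {a b c d : E}
    (ha : a ∈ H) (hb : b ∈ H) (hc : c ∈ H) (hd : d ∈ H) (h : a + I • b = c + I • d) :
    a = c ∧ b = d := by
  have hac : a = c := sub_eq_zero.mp <| hcap _ (H.sub_mem ha hc) _ (H.sub_mem hd hb) <| by
    rw [smul_sub, sub_eq_sub_iff_add_eq_add, h, add_comm]
  subst hac
  exact ⟨rfl, smul_right_injective E I_ne_zero (add_left_cancel h)⟩

open Complex in
/-- If a closed real subspace `H` of a complex Banach space satisfies `H + iH = E`, then every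
vector has a decomposition `ζ + iη` whose components are bounded in terms of its norm. -/
lemma Submodule.exists_add_I_smul_norm_le {E : Type*} [NormedAddCommGroup E] [NormedSpace ℂ E]
    [CompleteSpace E] (H : Submodule ℝ E) (hH : IsClosed (H : Set E))
    (hsum : ∀ z : E, ∃ ζ ∈ H, ∃ η ∈ H, z = ζ + I • η) :
    ∃ C : ℝ, ∀ z : E, ∃ ζ ∈ H, ∃ η ∈ H, z = ζ + I • η ∧ ‖ζ‖ ≤ C * ‖z‖ ∧ ‖η‖ ≤ C * ‖z‖ := by
  have : CompleteSpace H := hH.completeSpace_coe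
  let f : H × H →L[ℝ] E := H.subtypeL.coprod (I • H.subtypeL)
  have hf : Function.Surjective f := fun z ↦ by
    obtain ⟨ζ, hζ, η, hη, rfl⟩ := hsum z
    exact ⟨(⟨ζ, hζ⟩, ⟨η, hη⟩), by simp [f]⟩
  obtain ⟨C, -, hC⟩ := f.exists_preimage_norm_le hf
  refine ⟨C, fun z ↦ ?_⟩
  obtain ⟨p, hp, hpC⟩ := hC z
  exact ⟨p.1, p.1.2, p.2, p.2.2, by simp [← hp, f], (norm_fst_le p).trans hpC,
    (norm_snd_le p).trans hpC⟩


/-!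
STATEMENT 9. Let `𝔥` be a complex Hilbert space and `H₁` a closed real-linear subspace with
`H₁ ∩ iH₁ = {0}` and `H₁ + iH₁ = 𝔥`.  Then the map `s` defined by `s(ζ + iη) = -ζ + iη`
(`ζ, η ∈ H₁`) is well defined (i.e. there is a unique such map), conjugate-linear, bounded,
and satisfies `s² = I`; in particular `s ζ = -ζ` and `s (iζ) = iζ` for `ζ ∈ H₁`.
-/
theorem stmt9 {𝓗 : Type*} [NormedAddCommGroup 𝓗] [InnerProductSpace ℂ 𝓗] [CompleteSpace 𝓗]
    (H₁ : Submodule ℝ 𝓗) (hH₁closed : IsClosed (H₁ : Set 𝓗))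
    (hcap : ∀ x ∈ H₁, ∀ y ∈ H₁, x = Complex.I • y → x = 0)
    (hsum : ∀ z : 𝓗, ∃ ζ ∈ H₁, ∃ η ∈ H₁, z = ζ + Complex.I • η) :
    (∃! s : 𝓗 → 𝓗, ∀ ζ ∈ H₁, ∀ η ∈ H₁, s (ζ + Complex.I • η) = -ζ + Complex.I • η) ∧
    (∀ s : 𝓗 → 𝓗, (∀ ζ ∈ H₁, ∀ η ∈ H₁, s (ζ + Complex.I • η) = -ζ + Complex.I • η) →
      (∀ x y : 𝓗, s (x + y) = s x + s y) ∧
      (∀ (c : ℂ) (x : 𝓗), s (c • x) = (starRingEnd ℂ) c • s x) ∧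
      (∃ C : ℝ, ∀ x : 𝓗, ‖s x‖ ≤ C * ‖x‖) ∧
      (∀ x : 𝓗, s (s x) = x) ∧
      (∀ ζ ∈ H₁, s ζ = -ζ) ∧
      (∀ ζ ∈ H₁, s (Complex.I • ζ) = Complex.I • ζ)) := by
  refine ⟨?_, fun s hs ↦ ?_⟩
  · choose ζ hζ η hη hz using hsum
    refine ⟨fun z ↦ -ζ z + Complex.I • η z, fun a ha b hb ↦ ?_, fun t ht ↦ funext fun z ↦ ?_⟩
    · obtain ⟨h₁, h₂⟩ := H₁.eq_and_eq_of_add_I_smul_eq hcap (hζ _) (hη _) ha hb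
        (hz (a + Complex.I • b)).symm
      simp only [h₁, h₂]
    · conv_lhs => rw [hz z]
      exact ht _ (hζ z) _ (hη z)
  · refine ⟨fun x y ↦ ?_, fun c x ↦ ?_, ?_, fun x ↦ ?_, fun ζ hζ ↦ ?_, fun ζ hζ ↦ ?_⟩
    · obtain ⟨a, ha, b, hb, rfl⟩ := hsum x
      obtain ⟨c, hc, d, hd, rfl⟩ := hsum y
      have h := hs _ (H₁.add_mem ha hc) _ (H₁.add_mem hb hd)
      rw [hs a ha b hb, hs c hc d hd, add_add_add_comm, ← smul_add, h]
      module
    · obtain ⟨a, ha, b, hb, rfl⟩ := hsum x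
      have h := hs _ (H₁.sub_mem (H₁.smul_mem c.re ha) (H₁.smul_mem c.im hb))
        _ (H₁.add_mem (H₁.smul_mem c.re hb) (H₁.smul_mem c.im ha))
      have hc : c • (a + Complex.I • b) =
          c.re • a - c.im • b + Complex.I • (c.re • b + c.im • a) := by
        conv_lhs => rw [← Complex.re_add_im c]
        simp only [← Complex.coe_smul]
        match_scalars <;> grind [Complex.I_mul_I]
      rw [hc, h, hs a ha b hb]
      conv_rhs => rw [← Complex.re_add_im c]
      simp only [← Complex.coe_smul, map_add, map_mul, Complex.conj_ofReal, Complex.conj_I]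
      match_scalars <;> grind [Complex.I_mul_I]
    · obtain ⟨C, hC⟩ := H₁.exists_add_I_smul_norm_le hH₁closed hsum
      refine ⟨C + C, fun x ↦ ?_⟩
      obtain ⟨ζ, hζ, η, hη, hx, hζC, hηC⟩ := hC x
      calc ‖s x‖ = ‖-ζ + Complex.I • η‖ := by rw [← hs ζ hζ η hη, ← hx]
        _ ≤ ‖ζ‖ + ‖η‖ := (norm_add_le _ _).trans_eq (by simp [norm_smul])
        _ ≤ (C + C) * ‖x‖ := by linarith
    · obtain ⟨a, ha, b, hb, rfl⟩ := hsum x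
      rw [hs a ha b hb, hs _ (H₁.neg_mem ha) b hb, neg_neg]
    · simpa using hs ζ hζ 0 H₁.zero_mem
    · simpa using hs 0 H₁.zero_mem ζ hζ
end

section
/- Let S be a closable linear operator in a complex Hilbert space H with closure S̄, and let V : H₀ → H be an everywhere-defined isometric linear operator from a Hilbert space H₀ into H such that S̄ V V* ⊇ V V* S̄. Then V* S̄ V (an operator in H₀ with domain {x ∈ H₀ : Vx ∈ Dom S̄}) is closed, and V*(Dom S) is a core for both S̄ V and V* S̄ V. Moreover, if S is also densely defined, then (V* S̄ V)* = V* S* V. -/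
/-!
STATEMENT 13.  Let `S` be a closable operator in a complex Hilbert space `H` with closure `S̄`,
and let `V : H₀ → H` be an everywhere-defined isometric operator with `S̄ V V* ⊇ V V* S̄`.
Then `V* S̄ V` is closed, and `V*(Dom S)` is a core for both `S̄ V` and `V* S̄ V`.
Moreover, if `S` is densely defined then `(V* S̄ V)* = V* S* V`.
-/

/-- The composition `T ∘ B` of a partially defined operator `T` with an everywhere-defined
bounded operator `B`; its domain is `{x : B x ∈ Dom T}`. -/
noncomputable def pmapCompCLM {E F G : Type*}
    [NormedAddCommGroup E] [InnerProductSpace ℂ E]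
    [NormedAddCommGroup F] [InnerProductSpace ℂ F]
    [NormedAddCommGroup G] [InnerProductSpace ℂ G]
    (T : F →ₗ.[ℂ] G) (B : E →L[ℂ] F) : E →ₗ.[ℂ] G :=
  T.comp ((B : E →ₗ[ℂ] F).toPMap (T.domain.comap (B : E →ₗ[ℂ] F))) (fun x => x.2)

namespace LinearPMap

section Algebra

variable {R E F G : Type*} [Ring R] [AddCommGroup E] [Module R E]
  [AddCommGroup F] [Module R F] [AddCommGroup G] [Module R G]

theorem mem_graph_compPMap_iff (g : F →ₗ[R] G) (f : E →ₗ.[R] F) (x : E) (z : G) :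
    (x, z) ∈ (g.compPMap f).graph ↔ ∃ y, (x, y) ∈ f.graph ∧ g y = z := by
  simp only [mem_graph_iff]
  constructor
  · rintro ⟨a, ha, hz⟩
    exact ⟨f a, ⟨a, ha, rfl⟩, hz⟩
  · rintro ⟨_, ⟨a, ha, rfl⟩, hz⟩
    exact ⟨a, ha, hz⟩

theorem mem_graph_domRestrict_iff (f : E →ₗ.[R] F) (p : Submodule R E) (x : E) (y : F) :
    (x, y) ∈ (f.domRestrict p).graph ↔ (x, y) ∈ f.graph ∧ x ∈ p := by
  simp only [mem_graph_iff]
  constructor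
  · rintro ⟨a, rfl, rfl⟩
    exact ⟨⟨⟨a, a.2.2⟩, rfl, (domRestrict_apply rfl).symm⟩, a.2.1⟩
  · rintro ⟨⟨a, rfl, rfl⟩, hp⟩
    exact ⟨⟨a, hp, a.2⟩, rfl, domRestrict_apply rfl⟩

end Algebra

section Topology

variable {R E F E' F' : Type*} [CommRing R] [TopologicalSpace R]
  [AddCommGroup E] [Module R E] [TopologicalSpace E] [ContinuousAdd E] [ContinuousSMul R E]
  [AddCommGroup F] [Module R F] [TopologicalSpace F] [ContinuousAdd F] [ContinuousSMul R F]
  [AddCommGroup E'] [Module R E'] [TopologicalSpace E'] [ContinuousAdd E'] [ContinuousSMul R E']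
  [AddCommGroup F'] [Module R F'] [TopologicalSpace F'] [ContinuousAdd F'] [ContinuousSMul R F']

theorem IsClosed.closure_eq_of_le {f g : E →ₗ.[R] F} (hf : f.IsClosed) (hg : g ≤ f)
    (h : f.graph ≤ g.graph.topologicalClosure) : g.closure = f := by
  apply eq_of_eq_graph
  rw [← (hf.isClosable.leIsClosable hg).graph_closure_eq_closure_graph]
  exact le_antisymm (Submodule.topologicalClosure_minimal _ (le_graph_of_le hg) hf) h

/-- If `A × B` maps the graph of a closable operator `S` into the graph of a closed operator `f`
and the graph of `S.closure` onto it, then `A (Dom S)` is a core for `f`. -/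
theorem IsClosed.closure_domRestrict_map {f : E' →ₗ.[R] F'} (hf : f.IsClosed)
    {S : E →ₗ.[R] F} (hS : S.IsClosable) (A : E →L[R] E') (B : F →L[R] F')
    (hmap : ∀ s t, (s, t) ∈ S.graph → (A s, B t) ∈ f.graph)
    (hsurj : ∀ x y, (x, y) ∈ f.graph → ∃ p q, (p, q) ∈ S.closure.graph ∧ A p = x ∧ B q = y) :
    (f.domRestrict (S.domain.map (A : E →ₗ[R] E'))).closure = f := by
  refine hf.closure_eq_of_le domRestrict_le ?_
  rintro ⟨x, y⟩ hxy
  obtain ⟨p, q, hpq, rfl, rfl⟩ := hsurj x y hxy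
  rw [← hS.graph_closure_eq_closure_graph] at hpq
  refine map_mem_closure (f := Prod.map A B) (A.continuous.prodMap B.continuous) hpq ?_
  rintro ⟨s, t⟩ hst
  exact (mem_graph_domRestrict_iff _ _ _ _).2
    ⟨hmap s t hst, Submodule.mem_map_of_mem (mem_domain_of_mem_graph hst)⟩

end Topology

section Hilbert

variable {𝕜 E F : Type*} [RCLike 𝕜] [NormedAddCommGroup E] [InnerProductSpace 𝕜 E]
  [NormedAddCommGroup F] [InnerProductSpace 𝕜 F] [CompleteSpace E]

theorem mem_graph_adjoint_iff {T : E →ₗ.[𝕜] F} (hT : Dense (T.domain : Set E)) (y : F) (z : E) :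
    (y, z) ∈ T.adjoint.graph ↔ ∀ a b, (a, b) ∈ T.graph → inner 𝕜 b y = inner 𝕜 a z := by
  simp only [adjoint_graph_eq_graph_adjoint hT, Submodule.mem_adjoint_iff, sub_eq_zero]

theorem IsClosable.inner_eq_of_mem_graph_closure {T : E →ₗ.[𝕜] F} (hT : T.IsClosable)
    (hd : Dense (T.domain : Set E)) {y : F} {z : E} (h : (y, z) ∈ T.adjoint.graph)
    {a : E} {b : F} (hab : (a, b) ∈ T.closure.graph) : inner 𝕜 b y = inner 𝕜 a z := by
  rw [mem_graph_adjoint_iff hd] at h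
  rw [← hT.graph_closure_eq_closure_graph] at hab
  have hc : _root_.IsClosed {p : E × F | inner 𝕜 p.2 y = inner 𝕜 p.1 z} :=
    isClosed_eq (by fun_prop) (by fun_prop)
  exact closure_minimal (fun p hp ↦ h p.1 p.2 hp) hc hab

end Hilbert

end LinearPMap

theorem mem_graph_pmapCompCLM_iff {E F G : Type*}
    [NormedAddCommGroup E] [InnerProductSpace ℂ E]
    [NormedAddCommGroup F] [InnerProductSpace ℂ F]
    [NormedAddCommGroup G] [InnerProductSpace ℂ G]
    (T : F →ₗ.[ℂ] G) (B : E →L[ℂ] F) (x : E) (z : G) :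
    (x, z) ∈ (pmapCompCLM T B).graph ↔ (B x, z) ∈ T.graph := by
  simp only [LinearPMap.mem_graph_iff]
  constructor
  · rintro ⟨a, rfl, rfl⟩
    exact ⟨⟨B a, a.2⟩, rfl, rfl⟩
  · rintro ⟨a, ha, rfl⟩
    have hx : B x ∈ T.domain := ha ▸ a.2
    obtain rfl : a = ⟨B x, hx⟩ := Subtype.ext ha
    exact ⟨⟨x, hx⟩, rfl, rfl⟩

theorem stmt13 {H₀ H : Type*}
    [NormedAddCommGroup H₀] [InnerProductSpace ℂ H₀] [CompleteSpace H₀]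
    [NormedAddCommGroup H] [InnerProductSpace ℂ H] [CompleteSpace H]
    (S : H →ₗ.[ℂ] H) (hS : S.IsClosable)
    (V : H₀ →L[ℂ] H) (hV : ∀ x : H₀, ‖V x‖ = ‖x‖)
    -- `S̄ V V* ⊇ V V* S̄`:
    (hcomm : ∀ (x : H) (hx : x ∈ S.closure.domain),
      ∃ h' : V (ContinuousLinearMap.adjoint V x) ∈ S.closure.domain,
        S.closure ⟨V (ContinuousLinearMap.adjoint V x), h'⟩ =
          V (ContinuousLinearMap.adjoint V (S.closure ⟨x, hx⟩))) :
    -- `V* S̄ V` is closed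
    (LinearMap.compPMap (ContinuousLinearMap.adjoint V : H →ₗ[ℂ] H₀)
        (pmapCompCLM S.closure V)).IsClosed ∧
    -- `V*(Dom S)` is a core for `S̄ V`
    ((pmapCompCLM S.closure V).domRestrict
        (S.domain.map (ContinuousLinearMap.adjoint V : H →ₗ[ℂ] H₀))).closure
      = pmapCompCLM S.closure V ∧
    -- `V*(Dom S)` is a core for `V* S̄ V`
    ((LinearMap.compPMap (ContinuousLinearMap.adjoint V : H →ₗ[ℂ] H₀)
        (pmapCompCLM S.closure V)).domRestrict
        (S.domain.map (ContinuousLinearMap.adjoint V : H →ₗ[ℂ] H₀))).closure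
      = LinearMap.compPMap (ContinuousLinearMap.adjoint V : H →ₗ[ℂ] H₀)
          (pmapCompCLM S.closure V) ∧
    -- if `S` is densely defined then `(V* S̄ V)* = V* S* V`
    (Dense (S.domain : Set H) →
      (LinearMap.compPMap (ContinuousLinearMap.adjoint V : H →ₗ[ℂ] H₀)
          (pmapCompCLM S.closure V)).adjoint
        = LinearMap.compPMap (ContinuousLinearMap.adjoint V : H →ₗ[ℂ] H₀)
            (pmapCompCLM S.adjoint V)) := by
  set W := ContinuousLinearMap.adjoint V with hW
  have hWV (x : H₀) : W (V x) = x :=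
    DFunLike.congr_fun (V.norm_map_iff_adjoint_comp_self.1 hV) x
  have hVW {s t : H} (hst : (s, t) ∈ S.closure.graph) :
      (V (W s), V (W t)) ∈ S.closure.graph := by
    obtain ⟨a, rfl, rfl⟩ := (LinearPMap.mem_graph_iff _).1 hst
    obtain ⟨h', h⟩ := hcomm a a.2
    exact (LinearPMap.mem_graph_iff _).2 ⟨⟨_, h'⟩, rfl, h⟩
  have hrange {x : H₀} {z : H} (h : (V x, z) ∈ S.closure.graph) : V (W z) = z := by
    have h' := hVW h
    rw [hWV] at h'
    exact S.closure.mem_graph_snd_inj h' h rfl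
  have hA (x y : H₀) :
      (x, y) ∈ (LinearMap.compPMap (W : H →ₗ[ℂ] H₀) (pmapCompCLM S.closure V)).graph ↔
        (V x, V y) ∈ S.closure.graph := by
    rw [LinearPMap.mem_graph_compPMap_iff]
    simp only [mem_graph_pmapCompCLM_iff]
    constructor
    · rintro ⟨z, hz, rfl⟩
      exact (hrange hz).symm ▸ hz
    · exact fun h ↦ ⟨V y, h, hWV y⟩
  have hSS {s t : H} (h : (s, t) ∈ S.graph) : (s, t) ∈ S.closure.graph :=
    LinearPMap.le_graph_of_le S.le_closure h
  have hclosed : (LinearMap.compPMap (W : H →ₗ[ℂ] H₀) (pmapCompCLM S.closure V)).IsClosed := by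
    have h := hS.closure_isClosed.preimage (V.continuous.prodMap V.continuous)
    refine (congrArg _root_.IsClosed (Set.ext ?_)).mpr h
    rintro ⟨x, y⟩
    exact hA x y
  have hclosed' : (pmapCompCLM S.closure V).IsClosed := by
    have h := hS.closure_isClosed.preimage (V.continuous.prodMap continuous_id)
    refine (congrArg _root_.IsClosed (Set.ext ?_)).mpr h
    rintro ⟨x, y⟩
    exact mem_graph_pmapCompCLM_iff _ _ x y
  refine ⟨hclosed, ?_, ?_, fun hd ↦ ?_⟩
  · refine hclosed'.closure_domRestrict_map hS W (V.comp W) (fun s t hst ↦ ?_) fun x y hxy ↦ ?_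
    · exact (mem_graph_pmapCompCLM_iff _ _ _ _).2 (hVW (hSS hst))
    · rw [mem_graph_pmapCompCLM_iff] at hxy
      exact ⟨V x, y, hxy, hWV x, hrange hxy⟩
  · refine hclosed.closure_domRestrict_map hS W W (fun s t hst ↦ ?_) fun x y hxy ↦ ?_
    · exact (hA _ _).2 (hVW (hSS hst))
    · exact ⟨V x, V y, (hA _ _).1 hxy, hWV x, hWV y⟩
  · have hAd : Dense
        ((LinearMap.compPMap (W : H →ₗ[ℂ] H₀) (pmapCompCLM S.closure V)).domain : Set H₀) := by
      have hsurj : Function.Surjective W := fun x ↦ ⟨V x, hWV x⟩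
      refine (hsurj.denseRange.dense_image W.continuous hd).mono ?_
      rintro _ ⟨s, hs, rfl⟩
      exact LinearPMap.mem_domain_of_mem_graph
        ((hA _ _).2 (hVW (hSS (S.mem_graph ⟨s, hs⟩))))
    apply LinearPMap.eq_of_eq_graph
    ext ⟨u, v⟩
    rw [LinearPMap.mem_graph_adjoint_iff hAd, LinearPMap.mem_graph_compPMap_iff]
    simp only [mem_graph_pmapCompCLM_iff]
    constructor
    · refine fun h ↦ ⟨V v, (LinearPMap.mem_graph_adjoint_iff hd _ _).2 fun s t hst ↦ ?_, hWV v⟩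
      rw [← ContinuousLinearMap.adjoint_inner_left, ← ContinuousLinearMap.adjoint_inner_left]
      exact h _ _ ((hA _ _).2 (hVW (hSS hst)))
    · rintro ⟨z, hz, rfl⟩ a b hab
      have h := hS.inner_eq_of_mem_graph_closure hd hz ((hA _ _).1 hab)
      rw [← ContinuousLinearMap.adjoint_inner_left, ← hW, hWV] at h
      rw [h]
      exact (ContinuousLinearMap.adjoint_inner_right V a z).symm
end

section
/- For i = 1, 2, let T_i be a closable, densely defined linear operator from a complex Hilbert space H_i to a complex Hilbert space H_i′, and let T := T₁ ⊗̲ T₂ be the algebraic tensor product operator with domain Dom T₁ ⊗̲ Dom T₂ inside the Hilbert space tensor product H₁ ⊗ H₂. Then: (i) T* equals the closure of T₁* ⊗̲ T₂*; (ii) the closure of T equals (T₁* ⊗̲ T₂*)*. -/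
open scoped ComplexInnerProductSpace

open Filter Topology TensorProduct

namespace Submodule

section Adjoint

variable {𝕜 E F : Type*} [RCLike 𝕜]
  [NormedAddCommGroup E] [InnerProductSpace 𝕜 E] [NormedAddCommGroup F] [InnerProductSpace 𝕜 F]

theorem mem_adjoint_iff_inner_eq {g : Submodule 𝕜 (E × F)} {x : F × E} :
    x ∈ g.adjoint ↔ ∀ p ∈ g, inner 𝕜 p.2 x.1 = inner 𝕜 p.1 x.2 := by
  simp [mem_adjoint_iff, sub_eq_zero]

theorem isClosed_adjoint (g : Submodule 𝕜 (E × F)) : IsClosed (g.adjoint : Set (F × E)) := by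
  have : (g.adjoint : Set (F × E)) =
      ⋂ p ∈ g, {x : F × E | inner 𝕜 p.2 x.1 = inner 𝕜 p.1 x.2} := by
    ext x
    simp only [SetLike.mem_coe, mem_adjoint_iff_inner_eq, Set.mem_iInter, Set.mem_ofPred_eq]
  rw [this]
  exact isClosed_biInter fun p _ ↦ isClosed_eq (by fun_prop) (by fun_prop)

theorem topologicalClosure_le_adjoint_adjoint (g : Submodule 𝕜 (E × F)) :
    g.topologicalClosure ≤ g.adjoint.adjoint := by
  refine g.topologicalClosure_minimal (fun p hp ↦ ?_) (isClosed_adjoint _)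
  refine mem_adjoint_iff_inner_eq.2 fun x hx ↦ ?_
  rw [← inner_conj_symm, ← mem_adjoint_iff_inner_eq.1 hx p hp, inner_conj_symm]

theorem adjoint_topologicalClosure (g : Submodule 𝕜 (E × F)) :
    g.topologicalClosure.adjoint = g.adjoint := by
  refine le_antisymm (fun x hx ↦ mem_adjoint_iff_inner_eq.2 fun p hp ↦
    mem_adjoint_iff_inner_eq.1 hx p (g.le_topologicalClosure hp)) fun x hx ↦ ?_
  refine mem_adjoint_iff_inner_eq.2 fun p hp ↦ ?_
  have := mem_adjoint_iff_inner_eq.1 (topologicalClosure_le_adjoint_adjoint g hp) x hx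
  rw [← inner_conj_symm, ← this, inner_conj_symm]

theorem adjoint_adjoint [CompleteSpace E] [CompleteSpace F] (g : Submodule 𝕜 (E × F)) :
    g.adjoint.adjoint = g.topologicalClosure := by
  refine le_antisymm (fun p hp ↦ ?_) (topologicalClosure_le_adjoint_adjoint g)
  let L : WithLp 2 (E × F) ≃L[𝕜] E × F := WithLp.prodContinuousLinearEquiv 2 𝕜 E F
  let K : Submodule 𝕜 (WithLp 2 (E × F)) := g.topologicalClosure.comap (L : _ →ₗ[𝕜] E × F)
  have hK : IsClosed (K : Set (WithLp 2 (E × F))) :=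
    g.isClosed_topologicalClosure.preimage L.continuous
  have : L.symm p ∈ K.topologicalClosure := by
    rw [← K.orthogonal_orthogonal_eq_closure]
    refine (mem_orthogonal _ _).2 fun u hu ↦ ?_
    have hu' : (u.snd, -u.fst) ∈ g.adjoint := by
      refine mem_adjoint_iff_inner_eq.2 fun q hq ↦ ?_
      have := (mem_orthogonal _ _).1 hu (L.symm q) (g.le_topologicalClosure hq)
      simp only [WithLp.prod_inner_apply] at this
      rw [inner_neg_right]
      exact eq_neg_of_add_eq_zero_right this
    have := mem_adjoint_iff_inner_eq.1 hp _ hu'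
    rw [WithLp.prod_inner_apply]
    simp only [inner_neg_left] at this
    rw [neg_eq_iff_add_eq_zero] at this
    exact this
  rw [hK.submodule_topologicalClosure_eq] at this
  simpa [K] using this

/-- The regularizations `R = (1 + t² T* T)⁻¹`, `R' = (1 + t² T T*)⁻¹`, `C = T R` and `D = T* R'`
of the closed operator `T` with graph `g`. -/
theorem exists_regularization [CompleteSpace E] [CompleteSpace F] {g : Submodule 𝕜 (E × F)}
    (hg : IsClosed (g : Set (E × F))) {t : ℝ} (ht : 0 < t) :
    ∃ (R : E →L[𝕜] E) (R' : F →L[𝕜] F) (C : E →L[𝕜] F) (D : F →L[𝕜] E),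
      ‖R‖ ≤ 1 ∧ ‖R'‖ ≤ 1 ∧ (∀ x, (R x, C x) ∈ g) ∧ (∀ y, (R' y, D y) ∈ g.adjoint) ∧
      (∀ x z, inner 𝕜 (R x) z = inner 𝕜 x (R z)) ∧ (∀ x y, inner 𝕜 (C x) y = inner 𝕜 x (D y)) ∧
      (∀ p ∈ g, ‖R p.1 - p.1‖ ≤ t * ‖p.2‖) ∧ (∀ p ∈ g.adjoint, ‖R' p.1 - p.1‖ ≤ t * ‖p.2‖) := by
  have ht0 : (t : 𝕜) ≠ 0 := by exact_mod_cast ht.ne'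
  let M : WithLp 2 (E × F) →L[𝕜] E × F :=
    (WithLp.fstL 2 𝕜 E F).prod ((t : 𝕜)⁻¹ • WithLp.sndL 2 𝕜 E F)
  let K : Submodule 𝕜 (WithLp 2 (E × F)) := g.comap (M : _ →ₗ[𝕜] E × F)
  have hKmem (z : WithLp 2 (E × F)) : z ∈ K ↔ (z.fst, (t : 𝕜)⁻¹ • z.snd) ∈ g := Iff.rfl
  have hK : IsClosed (K : Set (WithLp 2 (E × F))) := hg.preimage M.continuous
  have : CompleteSpace K := hK.completeSpace_coe
  let P := K.starProjection
  have hP (z : WithLp 2 (E × F)) : ‖P z‖ ≤ ‖z‖ := by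
    simpa using P.le_of_opNorm_le K.starProjection_norm_le z
  have hP' (z : WithLp 2 (E × F)) : ‖z - P z‖ ≤ ‖z‖ := by
    simpa [P] using (Kᗮ.starProjection).le_of_opNorm_le Kᗮ.starProjection_norm_le z
  have hPs (u v : WithLp 2 (E × F)) : inner 𝕜 (P u) v = inner 𝕜 u (P v) :=
    K.inner_starProjection_left_eq_right u v
  let i : E →L[𝕜] WithLp 2 (E × F) :=
    (WithLp.prodContinuousLinearEquiv 2 𝕜 E F).symm ∘L .inl 𝕜 E F
  let j : F →L[𝕜] WithLp 2 (E × F) :=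
    (WithLp.prodContinuousLinearEquiv 2 𝕜 E F).symm ∘L .inr 𝕜 E F
  have hi (x : E) : i x = WithLp.toLp 2 (x, 0) := rfl
  have hj (y : F) : j y = WithLp.toLp 2 (0, y) := rfl
  have hin (x : E) : ‖i x‖ = ‖x‖ := WithLp.norm_toLp_fst 2 E F x
  have hjn (y : F) : ‖j y‖ = ‖y‖ := WithLp.norm_toLp_snd 2 E F y
  have hii (x : E) (v : WithLp 2 (E × F)) : inner 𝕜 (i x) v = inner 𝕜 x v.fst := by
    simp [hi, WithLp.prod_inner_apply]
  have hii' (x : E) (v : WithLp 2 (E × F)) : inner 𝕜 v (i x) = inner 𝕜 v.fst x := by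
    simp [hi, WithLp.prod_inner_apply]
  have hjj (y : F) (v : WithLp 2 (E × F)) : inner 𝕜 v (j y) = inner 𝕜 v.snd y := by
    simp [hj, WithLp.prod_inner_apply]
  refine ⟨WithLp.fstL 2 𝕜 E F ∘L P ∘L i, WithLp.sndL 2 𝕜 E F ∘L (.id 𝕜 _ - P) ∘L j,
    (t : 𝕜)⁻¹ • (WithLp.sndL 2 𝕜 E F ∘L P ∘L i), (t : 𝕜)⁻¹ • (WithLp.fstL 2 𝕜 E F ∘L P ∘L j),
    ?_, ?_, ?_, ?_, ?_, ?_, ?_, ?_⟩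
  · refine ContinuousLinearMap.opNorm_le_bound _ zero_le_one fun x ↦ ?_
    rw [one_mul, ← hin x]
    exact (WithLp.norm_fst_le _ _).trans (hP _)
  · refine ContinuousLinearMap.opNorm_le_bound _ zero_le_one fun y ↦ ?_
    rw [one_mul, ← hjn y]
    exact (WithLp.norm_snd_le _ _).trans (hP' _)
  · exact fun x ↦ (hKmem _).1 (K.starProjection_apply_mem (i x))
  · intro y
    refine mem_adjoint_iff_inner_eq.2 fun p hp ↦ ?_
    have hmem : WithLp.toLp 2 (p.1, (t : 𝕜) • p.2) ∈ K := by simpa [hKmem, ht0] using hp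
    have := (mem_orthogonal _ _).1 (K.sub_starProjection_mem_orthogonal (j y)) _ hmem
    simp only [WithLp.prod_inner_apply, inner_smul_left, RCLike.conj_ofReal] at this
    have h1 : (j y - P (j y)).fst = -(P (j y)).fst := by simp [hj]
    change inner 𝕜 p.1 (j y - P (j y)).fst + t * inner 𝕜 p.2 (j y - P (j y)).snd = 0 at this
    change inner 𝕜 p.2 (j y - P (j y)).snd = inner 𝕜 p.1 ((t : 𝕜)⁻¹ • (P (j y)).fst)
    rw [h1, inner_neg_right] at this
    rw [inner_smul_right, eq_inv_mul_iff_mul_eq₀ ht0]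
    linear_combination this
  · intro x z
    change inner 𝕜 (P (i x)).fst z = inner 𝕜 x (P (i z)).fst
    rw [← hii, ← hii', hPs]
  · intro x y
    change inner 𝕜 ((t : 𝕜)⁻¹ • (P (i x)).snd) y = inner 𝕜 x ((t : 𝕜)⁻¹ • (P (j y)).fst)
    rw [inner_smul_left, inner_smul_right, ← hii, ← hjj, hPs, map_inv₀, RCLike.conj_ofReal]
  · intro p hp
    have hmem : i p.1 + j ((t : 𝕜) • p.2) ∈ K := by simpa [hKmem, hi, hj, ht0] using hp
    have h := starProjection_eq_self_iff.2 hmem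
    have h1 : P (i p.1) - i p.1 = j ((t : 𝕜) • p.2) - P (j ((t : 𝕜) • p.2)) := by
      rw [map_add] at h
      rw [sub_eq_sub_iff_add_eq_add, add_comm (j _), ← h]
    have h2 : (P (i p.1)).fst - p.1 = -(P (j ((t : 𝕜) • p.2))).fst := by
      simpa [hi, hj] using congrArg WithLp.fst h1
    change ‖(P (i p.1)).fst - p.1‖ ≤ _
    rw [h2, norm_neg]
    refine (WithLp.norm_fst_le _ _).trans ((hP _).trans ?_)
    rw [hjn, norm_smul, RCLike.norm_ofReal, abs_of_pos ht]
  · intro p hp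
    have hmem : j p.1 - i ((t : 𝕜) • p.2) ∈ Kᗮ := by
      refine (mem_orthogonal _ _).2 fun z hz ↦ ?_
      have := mem_adjoint_iff_inner_eq.1 hp _ ((hKmem z).1 hz)
      rw [inner_smul_left, map_inv₀, RCLike.conj_ofReal, inv_mul_eq_iff_eq_mul₀ ht0] at this
      rw [inner_sub_right, hjj, hii', inner_smul_right, this, sub_self]
    have h : P (j p.1 - i ((t : 𝕜) • p.2)) = 0 := K.starProjection_apply_eq_zero_iff.2 hmem
    rw [map_sub, sub_eq_zero] at h
    have h2 : (j p.1 - P (j p.1)).snd - p.1 = -(P (i ((t : 𝕜) • p.2))).snd := by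
      rw [← h]
      simp [hj]
    change ‖(j p.1 - P (j p.1)).snd - p.1‖ ≤ _
    rw [h2, norm_neg]
    refine (WithLp.norm_snd_le _ _).trans ((hP _).trans ?_)
    rw [hin, norm_smul, RCLike.norm_ofReal, abs_of_pos ht]

end Adjoint

end Submodule

section TensorProduct

variable {𝕜 : Type*} [RCLike 𝕜] {E F E' F' G G' : Type*}
  [NormedAddCommGroup E] [InnerProductSpace 𝕜 E] [NormedAddCommGroup F] [InnerProductSpace 𝕜 F]
  [NormedAddCommGroup E'] [InnerProductSpace 𝕜 E']
  [NormedAddCommGroup F'] [InnerProductSpace 𝕜 F']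
  [NormedAddCommGroup G] [InnerProductSpace 𝕜 G] [NormedAddCommGroup G'] [InnerProductSpace 𝕜 G']

/-- The isometry from the algebraic tensor product given by a bilinear map compatible with the
inner products. -/
noncomputable def LinearMap.tensorIsometry (b : E →ₗ[𝕜] F →ₗ[𝕜] G)
    (hb : ∀ (x z : E) (y w : F), inner 𝕜 (b x y) (b z w) = inner 𝕜 x z * inner 𝕜 y w) :
    E ⊗[𝕜] F →ₗᵢ[𝕜] G :=
  (TensorProduct.lift b).isometryOfInner fun u v ↦ by
    induction u with
    | zero => simp
    | add u₁ u₂ h₁ h₂ => simp only [map_add, inner_add_left, h₁, h₂]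
    | tmul x y =>
      induction v with
      | zero => simp
      | add v₁ v₂ h₁ h₂ => simp only [map_add, inner_add_right, h₁, h₂]
      | tmul z w => simp [hb]


namespace LinearIsometry

variable {J : E ⊗[𝕜] F →ₗᵢ[𝕜] G} {J' : E' ⊗[𝕜] F' →ₗᵢ[𝕜] G'}

/-- A closed submodule containing all elementary tensors built from two dense sets is everything. -/
theorem eq_top_of_tmul_mem (hJ : DenseRange J) {s : Set E} {t : Set F} (hs : Dense s)
    (ht : Dense t) {V : Submodule 𝕜 G} (hV : IsClosed (V : Set G))
    (h : ∀ x ∈ s, ∀ y ∈ t, J (x ⊗ₜ y) ∈ V) : V = ⊤ := by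
  have hmem (x : E) (y : F) : J (x ⊗ₜ y) ∈ V := by
    have hc : Continuous (Function.uncurry fun (x : E) (y : F) ↦ J (x ⊗ₜ[𝕜] y)) :=
      J.continuous.comp TensorProduct.continuous_tmul
    rw [← SetLike.mem_coe, ← hV.closure_eq]
    exact map_mem_closure₂ (f := fun x y ↦ J (x ⊗ₜ[𝕜] y)) hc (hs x) (ht y) h
  refine Submodule.eq_top_iff'.2 fun z ↦ hJ.induction_on z hV fun u ↦ ?_
  induction u with
  | zero => simp
  | add u v hu hv => rw [map_add]; exact V.add_mem hu hv
  | tmul x y => exact hmem x y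

variable (J J') in
/-- The extension of the algebraic tensor product of two bounded operators to the completed
tensor products. -/
noncomputable def tensorMap [CompleteSpace G'] (A : E →L[𝕜] E') (B : F →L[𝕜] F') : G →L[𝕜] G' :=
  (J'.toContinuousLinearMap ∘L TensorProduct.mapL A B).extend J.toContinuousLinearMap

theorem tensorMap_tmul [CompleteSpace G'] (hJ : DenseRange J) (A : E →L[𝕜] E')
    (B : F →L[𝕜] F') (x : E) (y : F) :
    tensorMap J J' A B (J (x ⊗ₜ y)) = J' (A x ⊗ₜ B y) :=
  ContinuousLinearMap.extend_eq (e := J.toContinuousLinearMap) _ hJ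
    J.isometry.isUniformInducing (x ⊗ₜ y)

theorem norm_tensorMap_le [CompleteSpace G'] (hJ : DenseRange J) (A : E →L[𝕜] E')
    (B : F →L[𝕜] F') :
    ‖tensorMap J J' A B‖ ≤ ‖A‖ * ‖B‖ := by
  have h := ContinuousLinearMap.opNorm_extend_le (N := 1) (e := J.toContinuousLinearMap)
    (J'.toContinuousLinearMap ∘L TensorProduct.mapL A B) hJ fun x ↦ by simp
  rw [NNReal.coe_one, one_mul] at h
  refine h.trans (ContinuousLinearMap.opNorm_le_bound _ (by positivity) fun u ↦ ?_)
  simpa using (TensorProduct.mapL A B).le_of_opNorm_le (TensorProduct.norm_mapL_le A B) u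

theorem inner_tensorMap_right (hJ' : DenseRange J') [CompleteSpace G] {A : E →L[𝕜] E'}
    {B : F →L[𝕜] F'} {A' : E' →L[𝕜] E} {B' : F' →L[𝕜] F}
    (hA : ∀ x y, inner 𝕜 (A x) y = inner 𝕜 x (A' y))
    (hB : ∀ x y, inner 𝕜 (B x) y = inner 𝕜 x (B' y)) (x : E) (y : F) (v : G') :
    inner 𝕜 (J (x ⊗ₜ y)) (tensorMap J' J A' B' v) = inner 𝕜 (J' (A x ⊗ₜ B y)) v := by
  let V : Submodule 𝕜 G' := LinearMap.ker
    (((innerSL 𝕜 (J (x ⊗ₜ y))) ∘L tensorMap J' J A' B' - innerSL 𝕜 (J' (A x ⊗ₜ B y)) :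
      G' →L[𝕜] 𝕜) : G' →ₗ[𝕜] 𝕜)
  have hV : V = ⊤ := by
    refine eq_top_of_tmul_mem hJ' dense_univ dense_univ
      (ContinuousLinearMap.isClosed_ker _) fun z _ w _ ↦ ?_
    simp [V, tensorMap_tmul hJ', J.inner_map_map, J'.inner_map_map, hA, hB]
  have : v ∈ V := hV ▸ Submodule.mem_top
  simpa [V, sub_eq_zero] using this

end LinearIsometry

/-- Contractions converging pointwise to the identity on a dense set converge pointwise. -/
theorem ContinuousLinearMap.tendsto_apply_self_of_dense {L : ℕ → E →L[𝕜] E} (hL : ∀ n, ‖L n‖ ≤ 1)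
    {s : Set E} (hs : Dense s) (h : ∀ x ∈ s, Tendsto (fun n ↦ L n x) atTop (𝓝 x)) (x : E) :
    Tendsto (fun n ↦ L n x) atTop (𝓝 x) := by
  rw [Metric.tendsto_atTop]
  intro ε hε
  obtain ⟨y, hy, hxy⟩ := hs.exists_dist_lt x (show 0 < ε / 3 by positivity)
  obtain ⟨N, hN⟩ := Metric.tendsto_atTop.1 (h y hy) (ε / 3) (by positivity)
  refine ⟨N, fun n hn ↦ ?_⟩
  have h1 : dist (L n x) (L n y) ≤ dist x y := by
    rw [dist_eq_norm, dist_eq_norm, ← map_sub]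
    simpa using (L n).le_of_opNorm_le (hL n) (x - y)
  have h2 := hN n hn
  have h3 := dist_triangle4 (L n x) (L n y) y x
  rw [dist_comm y x] at h3
  linarith

theorem LinearIsometry.tendsto_tensorMap_apply_self [CompleteSpace G] {J : E ⊗[𝕜] F →ₗᵢ[𝕜] G}
    (hJ : DenseRange J) {A : ℕ → E →L[𝕜] E} {B : ℕ → F →L[𝕜] F}
    (hA : ∀ n, ‖A n‖ ≤ 1) (hB : ∀ n, ‖B n‖ ≤ 1) (hA' : ∀ x, Tendsto (fun n ↦ A n x) atTop (𝓝 x))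
    (hB' : ∀ y, Tendsto (fun n ↦ B n y) atTop (𝓝 y)) (z : G) :
    Tendsto (fun n ↦ tensorMap J J (A n) (B n) z) atTop (𝓝 z) := by
  refine ContinuousLinearMap.tendsto_apply_self_of_dense (fun n ↦ ?_) hJ ?_ z
  · exact (norm_tensorMap_le hJ _ _).trans (mul_le_one₀ (hA n) (norm_nonneg _) (hB n))
  rintro _ ⟨u, rfl⟩
  induction u with
  | zero => simp
  | add u v hu hv => simpa only [map_add] using hu.add hv
  | tmul x y =>
    simp only [tensorMap_tmul hJ]
    exact ((J.continuous.comp TensorProduct.continuous_tmul).tendsto (x, y)).comp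
      ((hA' x).prodMk_nhds (hB' y))

namespace Submodule

theorem exists_regularization_seq [CompleteSpace E] [CompleteSpace F] {g : Submodule 𝕜 (E × F)}
    (hg : Dense (Prod.fst '' (g : Set (E × F))))
    (hg' : Dense (Prod.fst '' (g.adjoint : Set (F × E)))) :
    ∃ (R : ℕ → E →L[𝕜] E) (R' : ℕ → F →L[𝕜] F) (C : ℕ → E →L[𝕜] F) (D : ℕ → F →L[𝕜] E),
      (∀ n, ‖R n‖ ≤ 1) ∧ (∀ n, ‖R' n‖ ≤ 1) ∧
      (∀ n x, (R n x, C n x) ∈ g.topologicalClosure) ∧ (∀ n y, (R' n y, D n y) ∈ g.adjoint) ∧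
      (∀ n x z, inner 𝕜 (R n x) z = inner 𝕜 x (R n z)) ∧
      (∀ n x y, inner 𝕜 (C n x) y = inner 𝕜 x (D n y)) ∧
      (∀ x, Tendsto (fun n ↦ R n x) atTop (𝓝 x)) ∧
      (∀ y, Tendsto (fun n ↦ R' n y) atTop (𝓝 y)) := by
  choose R R' C D hR hR' hC hD hRs hCs hRg hRg' using fun n : ℕ ↦
    exists_regularization g.isClosed_topologicalClosure (Nat.one_div_pos_of_nat (α := ℝ) (n := n))
  rw [adjoint_topologicalClosure] at hD hRg'
  have hlim (c : ℝ) : Tendsto (fun n : ℕ ↦ 1 / ((n : ℝ) + 1) * c) atTop (𝓝 0) := by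
    simpa using tendsto_one_div_add_atTop_nhds_zero_nat.mul_const c
  refine ⟨R, R', C, D, hR, hR', hC, hD, hRs, hCs, ?_, ?_⟩
  · refine ContinuousLinearMap.tendsto_apply_self_of_dense hR hg ?_
    rintro _ ⟨p, hp, rfl⟩
    exact tendsto_iff_norm_sub_tendsto_zero.2 (squeeze_zero (fun _ ↦ norm_nonneg _)
      (fun n ↦ hRg n p (g.le_topologicalClosure hp)) (hlim _))
  · refine ContinuousLinearMap.tendsto_apply_self_of_dense hR' hg' ?_
    rintro _ ⟨p, hp, rfl⟩
    exact tendsto_iff_norm_sub_tendsto_zero.2 (squeeze_zero (fun _ ↦ norm_nonneg _)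
      (fun n ↦ hRg' n p hp) (hlim _))

/-- The graph of the algebraic tensor product of the operators with graphs `g₁` and `g₂`. -/
def tensorGraph (J : E ⊗[𝕜] F →ₗᵢ[𝕜] G) (J' : E' ⊗[𝕜] F' →ₗᵢ[𝕜] G') (g₁ : Submodule 𝕜 (E × E'))
    (g₂ : Submodule 𝕜 (F × F')) : Submodule 𝕜 (G × G') :=
  span 𝕜 {p | ∃ u ∈ g₁, ∃ v ∈ g₂, p = (J (u.1 ⊗ₜ v.1), J' (u.2 ⊗ₜ v.2))}

variable {J : E ⊗[𝕜] F →ₗᵢ[𝕜] G} {J' : E' ⊗[𝕜] F' →ₗᵢ[𝕜] G'} {g₁ : Submodule 𝕜 (E × E')}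
  {g₂ : Submodule 𝕜 (F × F')}

theorem mem_tensorGraph {u : E × E'} {v : F × F'} (hu : u ∈ g₁) (hv : v ∈ g₂) :
    (J (u.1 ⊗ₜ v.1), J' (u.2 ⊗ₜ v.2)) ∈ tensorGraph J J' g₁ g₂ :=
  subset_span ⟨u, hu, v, hv, rfl⟩

theorem dense_map_fst_tensorGraph (hJ : DenseRange J) (h₁ : Dense (Prod.fst '' (g₁ : Set (E × E'))))
    (h₂ : Dense (Prod.fst '' (g₂ : Set (F × F')))) :
    Dense ((tensorGraph J J' g₁ g₂).map (LinearMap.fst 𝕜 G G') : Set G) := by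
  rw [dense_iff_topologicalClosure_eq_top]
  refine LinearIsometry.eq_top_of_tmul_mem hJ h₁ h₂ (isClosed_topologicalClosure _) ?_
  rintro _ ⟨u, hu, rfl⟩ _ ⟨v, hv, rfl⟩
  exact le_topologicalClosure _ ⟨_, mem_tensorGraph hu hv, rfl⟩

theorem mem_adjoint_tensorGraph_iff {x : G' × G} :
    x ∈ (tensorGraph J J' g₁ g₂).adjoint ↔ ∀ u ∈ g₁, ∀ v ∈ g₂,
      inner 𝕜 (J' (u.2 ⊗ₜ v.2)) x.1 = inner 𝕜 (J (u.1 ⊗ₜ v.1)) x.2 := by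
  rw [mem_adjoint_iff_inner_eq]
  refine ⟨fun h u hu v hv ↦ h _ (mem_tensorGraph hu hv), fun h p hp ↦ ?_⟩
  induction hp using span_induction with
  | mem p hp =>
    obtain ⟨u, hu, v, hv, rfl⟩ := hp
    exact h u hu v hv
  | zero => simp
  | add p q _ _ hp hq => simp only [Prod.fst_add, Prod.snd_add, inner_add_left, hp, hq]
  | smul c p _ hp => simp only [Prod.smul_fst, Prod.smul_snd, inner_smul_left, hp]

theorem adjoint_tensorGraph_topologicalClosure :
    (tensorGraph J J' g₁.topologicalClosure g₂.topologicalClosure).adjoint =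
      (tensorGraph J J' g₁ g₂).adjoint := by
  ext x
  rw [mem_adjoint_tensorGraph_iff, mem_adjoint_tensorGraph_iff]
  refine ⟨fun h u hu v hv ↦ h u (g₁.le_topologicalClosure hu) v (g₂.le_topologicalClosure hv),
    fun h u hu v hv ↦ ?_⟩
  have hJ : Continuous fun q : (E × E') × (F × F') ↦ J (q.1.1 ⊗ₜ[𝕜] q.2.1) :=
    J.continuous.comp (TensorProduct.continuous_tmul.comp
      (f := fun q : (E × E') × (F × F') ↦ (q.1.1, q.2.1)) (by fun_prop))
  have hJ' : Continuous fun q : (E × E') × (F × F') ↦ J' (q.1.2 ⊗ₜ[𝕜] q.2.2) :=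
    J'.continuous.comp (TensorProduct.continuous_tmul.comp
      (f := fun q : (E × E') × (F × F') ↦ (q.1.2, q.2.2)) (by fun_prop))
  have hcl : IsClosed {q : (E × E') × (F × F') |
      inner 𝕜 (J' (q.1.2 ⊗ₜ q.2.2)) x.1 = inner 𝕜 (J (q.1.1 ⊗ₜ q.2.1)) x.2} :=
    isClosed_eq (hJ'.inner continuous_const) (hJ.inner continuous_const)
  have : (u, v) ∈ closure ((g₁ : Set (E × E')) ×ˢ (g₂ : Set (F × F'))) := by
    rw [closure_prod_eq]
    exact ⟨hu, hv⟩
  exact closure_minimal (fun q hq ↦ h q.1 hq.1 q.2 hq.2) hcl this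

theorem tensorGraph_adjoint_le :
    tensorGraph J' J g₁.adjoint g₂.adjoint ≤ (tensorGraph J J' g₁ g₂).adjoint := by
  refine span_le.2 ?_
  rintro _ ⟨x, hx, y, hy, rfl⟩
  refine mem_adjoint_tensorGraph_iff.2 fun u hu v hv ↦ ?_
  simp only [LinearIsometry.inner_map_map, TensorProduct.inner_tmul,
    mem_adjoint_iff_inner_eq.1 hx u hu, mem_adjoint_iff_inner_eq.1 hy v hv]

/-- The adjoint of the tensor product of two densely defined closable operators is the closure of
the tensor product of their adjoints. -/
theorem adjoint_tensorGraph [CompleteSpace E] [CompleteSpace F] [CompleteSpace E']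
    [CompleteSpace F'] [CompleteSpace G] [CompleteSpace G'] (hJ : DenseRange J)
    (hJ' : DenseRange J')
    (h₁ : Dense (Prod.fst '' (g₁ : Set (E × E')))) (h₂ : Dense (Prod.fst '' (g₂ : Set (F × F'))))
    (h₁' : Dense (Prod.fst '' (g₁.adjoint : Set (E' × E))))
    (h₂' : Dense (Prod.fst '' (g₂.adjoint : Set (F' × F)))) :
    (tensorGraph J J' g₁ g₂).adjoint =
      (tensorGraph J' J g₁.adjoint g₂.adjoint).topologicalClosure := by
  refine le_antisymm ?_ (topologicalClosure_minimal _ tensorGraph_adjoint_le (isClosed_adjoint _))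
  obtain ⟨R₁, R₁', C₁, D₁, hR₁, hR₁', hC₁, hD₁, hRs₁, hCs₁, hl₁, hl₁'⟩ :=
    exists_regularization_seq h₁ h₁'
  obtain ⟨R₂, R₂', C₂, D₂, hR₂, hR₂', hC₂, hD₂, hRs₂, hCs₂, hl₂, hl₂'⟩ :=
    exists_regularization_seq h₂ h₂'
  set S := tensorGraph J' J g₁.adjoint g₂.adjoint
  intro p hp
  have hmem (n : ℕ) (u : G') : (LinearIsometry.tensorMap J' J' (R₁' n) (R₂' n) u,
      LinearIsometry.tensorMap J' J (D₁ n) (D₂ n) u) ∈ S.topologicalClosure := by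
    let L : G' →L[𝕜] G' × G := (LinearIsometry.tensorMap J' J' (R₁' n) (R₂' n)).prod
      (LinearIsometry.tensorMap J' J (D₁ n) (D₂ n))
    have : S.topologicalClosure.comap (L : G' →ₗ[𝕜] G' × G) = ⊤ := by
      refine LinearIsometry.eq_top_of_tmul_mem hJ' dense_univ dense_univ
        (S.isClosed_topologicalClosure.preimage L.continuous) fun x _ y _ ↦ ?_
      refine S.le_topologicalClosure ?_
      simpa [L, LinearIsometry.tensorMap_tmul hJ'] using
        mem_tensorGraph (J := J') (J' := J) (hD₁ n x) (hD₂ n y)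
    exact (this ▸ mem_top : u ∈ S.topologicalClosure.comap (L : G' →ₗ[𝕜] G' × G))
  have heq (n : ℕ) : LinearIsometry.tensorMap J' J (D₁ n) (D₂ n) p.1 =
      LinearIsometry.tensorMap J J (R₁ n) (R₂ n) p.2 := by
    rw [← adjoint_tensorGraph_topologicalClosure, mem_adjoint_tensorGraph_iff] at hp
    refine hJ.eq_of_inner_right 𝕜 fun u ↦ ?_
    induction u with
    | zero => simp
    | add u v hu hv => simp only [map_add, inner_add_left, hu, hv]
    | tmul x y =>
      rw [LinearIsometry.inner_tensorMap_right hJ' (hCs₁ n) (hCs₂ n),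
        LinearIsometry.inner_tensorMap_right hJ (hRs₁ n) (hRs₂ n)]
      exact hp _ (hC₁ n x) _ (hC₂ n y)
  have hlim : Tendsto (fun n ↦ (LinearIsometry.tensorMap J' J' (R₁' n) (R₂' n) p.1,
      LinearIsometry.tensorMap J' J (D₁ n) (D₂ n) p.1)) atTop (𝓝 (p.1, p.2)) := by
    refine (LinearIsometry.tendsto_tensorMap_apply_self hJ' hR₁' hR₂' hl₁' hl₂' p.1).prodMk_nhds ?_
    simp only [heq]
    exact LinearIsometry.tendsto_tensorMap_apply_self hJ hR₁ hR₂ hl₁ hl₂ p.2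
  exact S.isClosed_topologicalClosure.mem_of_tendsto hlim (.of_forall fun n ↦ hmem n p.1)

end Submodule

end TensorProduct

namespace LinearPMap

variable {𝕜 E F : Type*} [RCLike 𝕜]
  [NormedAddCommGroup E] [InnerProductSpace 𝕜 E] [NormedAddCommGroup F] [InnerProductSpace 𝕜 F]

theorem image_fst_graph (T : E →ₗ.[𝕜] F) :
    Prod.fst '' (T.graph : Set (E × F)) = (T.domain : Set E) := by
  rw [← T.graph_map_fst_eq_domain]
  rfl

theorem closure_eq_of_graph {S T : E →ₗ.[𝕜] F} (h : S.graph.topologicalClosure = T.graph) :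
    S.closure = T := by
  have hS : S.IsClosable := ⟨T, h⟩
  exact eq_of_eq_graph (hS.graph_closure_eq_closure_graph.symm.trans h)

/-- The adjoint of a closable operator has dense domain. -/
theorem IsClosable.dense_image_fst_adjoint_graph [CompleteSpace E] [CompleteSpace F]
    {T : E →ₗ.[𝕜] F} (hT : T.IsClosable) :
    Dense (Prod.fst '' (T.graph.adjoint : Set (F × E))) := by
  change Dense (T.graph.adjoint.map (LinearMap.fst 𝕜 F E) : Set F)
  rw [Submodule.dense_iff_topologicalClosure_eq_top,
    Submodule.topologicalClosure_eq_top_iff, Submodule.eq_bot_iff]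
  intro y hy
  have hmem : ((0 : E), y) ∈ T.graph.topologicalClosure := by
    rw [← Submodule.adjoint_adjoint]
    refine Submodule.mem_adjoint_iff_inner_eq.2 fun p hp ↦ ?_
    rw [inner_zero_right]
    exact ((Submodule.mem_orthogonal _ _).1 hy _ ⟨p, hp, rfl⟩).symm
  obtain ⟨T', hT'⟩ := hT
  exact T'.graph_fst_eq_zero_snd (hT' ▸ hmem) rfl

theorem tensorGraph_graph_eq_span {E' F' G G' : Type*}
    [NormedAddCommGroup E'] [InnerProductSpace 𝕜 E']
    [NormedAddCommGroup F'] [InnerProductSpace 𝕜 F']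
    [NormedAddCommGroup G] [InnerProductSpace 𝕜 G] [NormedAddCommGroup G'] [InnerProductSpace 𝕜 G']
    (J : E ⊗[𝕜] F →ₗᵢ[𝕜] G) (J' : E' ⊗[𝕜] F' →ₗᵢ[𝕜] G') (T₁ : E →ₗ.[𝕜] E') (T₂ : F →ₗ.[𝕜] F') :
    Submodule.tensorGraph J J' T₁.graph T₂.graph =
      Submodule.span 𝕜 {p | ∃ (x : T₁.domain) (y : T₂.domain),
        p = (J ((x : E) ⊗ₜ (y : F)), J' (T₁ x ⊗ₜ T₂ y))} := by
  refine congrArg (Submodule.span 𝕜) (Set.ext fun p ↦ ⟨?_, ?_⟩)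
  · rintro ⟨⟨_, _⟩, hu, ⟨_, _⟩, hv, rfl⟩
    obtain ⟨x, rfl, rfl⟩ := (T₁.mem_graph_iff).1 hu
    obtain ⟨y, rfl, rfl⟩ := (T₂.mem_graph_iff).1 hv
    exact ⟨x, y, rfl⟩
  · rintro ⟨x, y, rfl⟩
    exact ⟨_, T₁.mem_graph x, _, T₂.mem_graph y, rfl⟩

end LinearPMap

theorem LinearMap.denseRange_tensorIsometry {𝕜 E F G : Type*} [RCLike 𝕜]
    [NormedAddCommGroup E] [InnerProductSpace 𝕜 E] [NormedAddCommGroup F] [InnerProductSpace 𝕜 F]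
    [NormedAddCommGroup G] [InnerProductSpace 𝕜 G] (b : E →ₗ[𝕜] F →ₗ[𝕜] G)
    (hb : ∀ (x z : E) (y w : F), inner 𝕜 (b x y) (b z w) = inner 𝕜 x z * inner 𝕜 y w)
    (hd : Dense (Submodule.span 𝕜 {z : G | ∃ x y, z = b x y} : Set G)) :
    DenseRange (b.tensorIsometry hb) := by
  refine hd.mono ?_
  change _ ≤ LinearMap.range (b.tensorIsometry hb).toLinearMap
  refine Submodule.span_le.2 ?_
  rintro _ ⟨x, y, rfl⟩
  exact ⟨x ⊗ₜ y, rfl⟩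


/-!
STATEMENT 14.  For `i = 1, 2` let `Tᵢ` be a closable densely defined operator from a complex
Hilbert space `Hᵢ` to a complex Hilbert space `Hᵢ'`, and let `T := T₁ ⊗̲ T₂` be the algebraic
tensor product operator on the Hilbert space tensor product `H₁ ⊗ H₂` (realised abstractly as
`G` with bilinear map `tm`, and `G'` with `tm'` for `H₁' ⊗ H₂'`).  Then
(i) `T* = closure (T₁* ⊗̲ T₂*)`, and (ii) `closure T = (T₁* ⊗̲ T₂*)*`.

The algebraic tensor product operators are characterised by their graphs, which are the spans
of the corresponding elementary pairs.
-/
theorem stmt14 {H₁ H₂ H₁' H₂' G G' : Type*}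
    [NormedAddCommGroup H₁] [InnerProductSpace ℂ H₁] [CompleteSpace H₁]
    [NormedAddCommGroup H₂] [InnerProductSpace ℂ H₂] [CompleteSpace H₂]
    [NormedAddCommGroup H₁'] [InnerProductSpace ℂ H₁'] [CompleteSpace H₁']
    [NormedAddCommGroup H₂'] [InnerProductSpace ℂ H₂'] [CompleteSpace H₂']
    [NormedAddCommGroup G] [InnerProductSpace ℂ G] [CompleteSpace G]
    [NormedAddCommGroup G'] [InnerProductSpace ℂ G'] [CompleteSpace G']
    (tm : H₁ →ₗ[ℂ] H₂ →ₗ[ℂ] G)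
    (htm_inner : ∀ (a c : H₁) (b d : H₂), ⟪tm a b, tm c d⟫ = ⟪a, c⟫ * ⟪b, d⟫)
    (htm_dense : Dense (Submodule.span ℂ {z : G | ∃ a b, z = tm a b} : Set G))
    (tm' : H₁' →ₗ[ℂ] H₂' →ₗ[ℂ] G')
    (htm'_inner : ∀ (a c : H₁') (b d : H₂'), ⟪tm' a b, tm' c d⟫ = ⟪a, c⟫ * ⟪b, d⟫)
    (htm'_dense : Dense (Submodule.span ℂ {z : G' | ∃ a b, z = tm' a b} : Set G'))
    (T₁ : H₁ →ₗ.[ℂ] H₁') (T₂ : H₂ →ₗ.[ℂ] H₂')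
    (h₁dense : Dense (T₁.domain : Set H₁)) (h₂dense : Dense (T₂.domain : Set H₂))
    (h₁closable : T₁.IsClosable) (h₂closable : T₂.IsClosable)
    -- `T` is the algebraic tensor product operator `T₁ ⊗̲ T₂`:
    (T : G →ₗ.[ℂ] G')
    (hT : T.graph = Submodule.span ℂ
      {p : G × G' | ∃ (x : T₁.domain) (y : T₂.domain),
        p = (tm (x : H₁) (y : H₂), tm' (T₁ x) (T₂ y))})
    -- `S` is the algebraic tensor product operator `T₁* ⊗̲ T₂*`:
    (S : G' →ₗ.[ℂ] G)
    (hS : S.graph = Submodule.span ℂ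
      {p : G' × G | ∃ (x : T₁.adjoint.domain) (y : T₂.adjoint.domain),
        p = (tm' (x : H₁') (y : H₂'), tm (T₁.adjoint x) (T₂.adjoint y))}) :
    T.adjoint = S.closure ∧ T.closure = S.adjoint := by
  let J := tm.tensorIsometry htm_inner
  let J' := tm'.tensorIsometry htm'_inner
  have hJ : DenseRange J := tm.denseRange_tensorIsometry htm_inner htm_dense
  have hJ' : DenseRange J' := tm'.denseRange_tensorIsometry htm'_inner htm'_dense
  have hT' : T.graph = Submodule.tensorGraph J J' T₁.graph T₂.graph :=
    hT.trans (LinearPMap.tensorGraph_graph_eq_span J J' T₁ T₂).symm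
  have hS' : S.graph = Submodule.tensorGraph J' J T₁.graph.adjoint T₂.graph.adjoint := by
    rw [← LinearPMap.adjoint_graph_eq_graph_adjoint h₁dense,
      ← LinearPMap.adjoint_graph_eq_graph_adjoint h₂dense]
    exact hS.trans (LinearPMap.tensorGraph_graph_eq_span J' J T₁.adjoint T₂.adjoint).symm
  have h₁ : Dense (Prod.fst '' (T₁.graph : Set (H₁ × H₁'))) := T₁.image_fst_graph ▸ h₁dense
  have h₂ : Dense (Prod.fst '' (T₂.graph : Set (H₂ × H₂'))) := T₂.image_fst_graph ▸ h₂dense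
  have h₁' := h₁closable.dense_image_fst_adjoint_graph
  have h₂' := h₂closable.dense_image_fst_adjoint_graph
  have hTd : Dense (T.domain : Set G) := by
    rw [← T.graph_map_fst_eq_domain, hT']
    exact Submodule.dense_map_fst_tensorGraph hJ h₁ h₂
  have hSd : Dense (S.domain : Set G') := by
    rw [← S.graph_map_fst_eq_domain, hS']
    exact Submodule.dense_map_fst_tensorGraph hJ' h₁' h₂'
  have key : T.graph.adjoint = S.graph.topologicalClosure := by
    rw [hT', hS']
    exact Submodule.adjoint_tensorGraph hJ hJ' h₁ h₂ h₁' h₂'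
  constructor
  · refine (LinearPMap.closure_eq_of_graph ?_).symm
    rw [LinearPMap.adjoint_graph_eq_graph_adjoint hTd, key]
  · refine LinearPMap.closure_eq_of_graph ?_
    rw [LinearPMap.adjoint_graph_eq_graph_adjoint hSd, ← Submodule.adjoint_topologicalClosure,
      ← key, Submodule.adjoint_adjoint]
end

section
/- For i = 1, 2, let T_i be an essentially selfadjoint operator in a complex Hilbert space H_i (a densely defined symmetric operator whose closure is selfadjoint). Then the algebraic tensor product operator T₁ ⊗̲ T₂, with domain Dom T₁ ⊗̲ Dom T₂ inside the Hilbert space tensor product H₁ ⊗ H₂, is essentially selfadjoint. -/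
open scoped ComplexInnerProductSpace
open scoped TensorProduct

section BoundedTransform

variable {H : Type*} [NormedAddCommGroup H] [InnerProductSpace ℂ H] [CompleteSpace H]

/-- For a selfadjoint `A`, the operators `D = (1 + A²)⁻¹` and `C = A (1 + A²)⁻¹` are bounded. -/
theorem exists_bounded_pair_of_isSelfAdjoint {A : H →ₗ.[ℂ] H} (hA : IsSelfAdjoint A) :
    ∃ C D : H →L[ℂ] H, (C : H →ₗ[ℂ] H).IsSymmetric ∧ (D : H →ₗ[ℂ] H).IsSymmetric ∧
      (∀ x, C (D x) = D (C x)) ∧ (∀ x, D x = 0 → x = 0) ∧ ∀ x, (D x, C x) ∈ A.graph := by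
  have hadj : A.graph.adjoint = A.graph := by
    rw [← LinearPMap.adjoint_graph_eq_graph_adjoint hA.dense_domain,
      LinearPMap.isSelfAdjoint_def.mp hA]
  have hs : ∀ {a b c d : H}, (a, b) ∈ A.graph → (c, d) ∈ A.graph → ⟪b, c⟫ = ⟪a, d⟫ := by
    intro a b c d hab hcd
    rw [← hadj, Submodule.mem_adjoint_iff] at hcd
    exact sub_eq_zero.mp (hcd a b hab)
  have hmax : ∀ {c d : H}, (∀ a b, (a, b) ∈ A.graph → ⟪b, c⟫ = ⟪a, d⟫) → (c, d) ∈ A.graph := by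
    intro c d h
    rw [← hadj, Submodule.mem_adjoint_iff]
    exact fun a b hab => sub_eq_zero.mpr (h a b hab)
  let e := WithLp.prodContinuousLinearEquiv 2 ℂ H H
  let K : Submodule ℂ (WithLp 2 (H × H)) := A.graph.comap (e : WithLp 2 (H × H) →ₗ[ℂ] H × H)
  have hKc : IsClosed (K : Set (WithLp 2 (H × H))) := hA.isClosed.preimage e.continuous
  have : CompleteSpace K := hKc.completeSpace_coe
  let F : H →L[ℂ] H × H :=
    (e : WithLp 2 (H × H) →L[ℂ] H × H) ∘L K.starProjection ∘L
      (e.symm : H × H →L[ℂ] WithLp 2 (H × H)) ∘L ContinuousLinearMap.inl ℂ H H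
  let D : H →L[ℂ] H := ContinuousLinearMap.fst ℂ H H ∘L F
  let C : H →L[ℂ] H := ContinuousLinearMap.snd ℂ H H ∘L F
  have h1 : ∀ x, (D x, C x) ∈ A.graph := fun x =>
    K.starProjection_apply_mem (e.symm (x, 0))
  have h2 : ∀ x, (C x, x - D x) ∈ A.graph := by
    intro x
    refine hmax fun a b hab => ?_
    have h := K.starProjection_inner_eq_zero (e.symm (x, 0)) (e.symm (a, b)) hab
    rw [WithLp.prod_inner_apply] at h
    have h' : ⟪x - D x, a⟫ + ⟪0 - C x, b⟫ = 0 := h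
    have h'' := congrArg (starRingEnd ℂ) h'
    rw [map_add, inner_conj_symm, inner_conj_symm, map_zero, zero_sub, inner_neg_right] at h''
    linear_combination -h''
  have huniq : ∀ {x u v : H}, (u, v) ∈ A.graph → (v, x - u) ∈ A.graph → u = D x := by
    intro x u v huv hvx
    have ha := A.graph.sub_mem huv (h1 x)
    have hb := A.graph.sub_mem hvx (h2 x)
    have h := hs ha hb
    simp only [] at h
    rw [show x - u - (x - D x) = -(u - D x) by abel, inner_neg_right,
      inner_self_eq_norm_sq_to_K, inner_self_eq_norm_sq_to_K] at h
    have h' : ‖v - C x‖ ^ 2 = -‖u - D x‖ ^ 2 := by exact_mod_cast h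
    have : ‖u - D x‖ = 0 := by nlinarith [sq_nonneg ‖v - C x‖, sq_nonneg ‖u - D x‖]
    exact sub_eq_zero.mp (norm_eq_zero.mp this)
  have h0 : ∀ {b : H}, ((0 : H), b) ∈ A.graph → b = 0 := fun hb => A.graph_fst_eq_zero_snd hb rfl
  refine ⟨C, D, fun x y => ?_, fun x y => ?_, fun x => ?_, fun x hx => ?_, h1⟩
  · have ha := hs (h2 x) (h2 y)
    have hb := hs (h1 x) (h1 y)
    simp only [inner_sub_left, inner_sub_right] at ha
    simp only [ContinuousLinearMap.coe_coe]
    linear_combination hb - ha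
  · have ha := hs (h1 x) (h2 y)
    have hb := hs (h2 x) (h1 y)
    simp only [inner_sub_left, inner_sub_right] at ha hb
    simp only [ContinuousLinearMap.coe_coe]
    linear_combination -ha - hb
  · exact huniq (h2 (D x)) (A.graph.sub_mem (h1 x) (h1 (D x)))
  · have ha := h1 x
    rw [hx] at ha
    have hb := h2 x
    rw [h0 ha, hx, sub_zero] at hb
    exact h0 hb

/-- An injective bounded symmetric operator has dense range. -/
theorem denseRange_of_isSymmetric {f : H →L[ℂ] H} (hf : (f : H →ₗ[ℂ] H).IsSymmetric)
    (hf0 : ∀ x, f x = 0 → x = 0) : DenseRange f := by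
  have h : Dense (LinearMap.range (f : H →ₗ[ℂ] H) : Set H) := by
    rw [Submodule.dense_iff_topologicalClosure_eq_top, Submodule.topologicalClosure_eq_top_iff,
      Submodule.eq_bot_iff]
    intro z hz
    refine hf0 z (inner_self_eq_zero (𝕜 := ℂ) |>.mp ?_)
    have h1 : ⟪f z, f z⟫ = ⟪f (f z), z⟫ := (hf (f z) z).symm
    rw [h1]
    exact hz _ ⟨f z, rfl⟩
  exact h

end BoundedTransform

section EssentialSelfAdjointness

variable {G : Type*} [NormedAddCommGroup G] [InnerProductSpace ℂ G] [CompleteSpace G]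

theorem LinearPMap.isClosable_of_isFormalAdjoint {T : G →ₗ.[ℂ] G}
    (hd : Dense (T.domain : Set G)) (hT : T.IsFormalAdjoint T) : T.IsClosable :=
  (adjoint_isClosed hd).isClosable.leIsClosable (hT.le_adjoint hd)

/-- A densely defined symmetric operator is essentially selfadjoint as soon as there are commuting
bounded symmetric `P`, `Q` with `Q` injective and `P w = Q (T† w)` on the domain of `T†`. -/
theorem LinearPMap.adjoint_closure_eq_closure_of_commuting_pair {T : G →ₗ.[ℂ] G}
    (hd : Dense (T.domain : Set G)) (hT : T.IsFormalAdjoint T) (P Q : G →L[ℂ] G)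
    (hP : (P : G →ₗ[ℂ] G).IsSymmetric) (hQ : (Q : G →ₗ[ℂ] G).IsSymmetric)
    (hPQ : ∀ z, P (Q z) = Q (P z)) (hQinj : ∀ z, Q z = 0 → z = 0)
    (h : ∀ w w', (w, w') ∈ T.graph.adjoint → P w = Q w') :
    T.closure.adjoint = T.closure := by
  have hclos := isClosable_of_isFormalAdjoint hd hT
  have hgraph := hclos.graph_closure_eq_closure_graph
  have hcd : Dense (T.closure.domain : Set G) := hd.mono T.le_closure.1
  have hTa : T.graph ≤ T.graph.adjoint := by
    rw [← adjoint_graph_eq_graph_adjoint hd]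
    exact le_graph_of_le (hT.le_adjoint hd)
  have hac : _root_.IsClosed (T.graph.adjoint : Set (G × G)) := by
    rw [← adjoint_graph_eq_graph_adjoint hd]
    exact adjoint_isClosed hd
  have hle : T.graph.topologicalClosure ≤ T.graph.adjoint :=
    Submodule.topologicalClosure_minimal _ hTa hac
  have hzero : ∀ w w', (w, w') ∈ T.graph.adjoint → (w', -w) ∈ T.graph.adjoint →
      w = 0 ∧ w' = 0 := by
    intro w w' h1 h2
    have e1 := h _ _ h1
    have e2 := h _ _ h2
    rw [_root_.map_neg] at e2
    have e3 : P (P w) = -Q (Q w) := by rw [e1, hPQ, e2, _root_.map_neg]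
    have e4 : ⟪P w, P w⟫ = -⟪Q w, Q w⟫ := by
      calc ⟪P w, P w⟫ = ⟪w, P (P w)⟫ := hP _ _
        _ = -⟪w, Q (Q w)⟫ := by rw [e3, inner_neg_right]
        _ = -⟪Q w, Q w⟫ := by rw [← ContinuousLinearMap.coe_coe Q, hQ]
    rw [inner_self_eq_norm_sq_to_K, inner_self_eq_norm_sq_to_K] at e4
    have e5 : ‖P w‖ ^ 2 = -‖Q w‖ ^ 2 := by exact_mod_cast e4
    have hw : w = 0 := hQinj _ <| norm_eq_zero.mp <| by
      nlinarith [sq_nonneg ‖P w‖, sq_nonneg ‖Q w‖]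
    refine ⟨hw, hQinj _ ?_⟩
    rw [← e1, hw, _root_.map_zero]
  have hge : T.graph.adjoint ≤ T.graph.topologicalClosure := by
    let e := WithLp.prodContinuousLinearEquiv 2 ℂ G G
    let K : Submodule ℂ (WithLp 2 (G × G)) :=
      T.graph.topologicalClosure.comap (e : WithLp 2 (G × G) →ₗ[ℂ] G × G)
    have hKc : _root_.IsClosed (K : Set (WithLp 2 (G × G))) :=
      T.graph.isClosed_topologicalClosure.preimage e.continuous
    have : CompleteSpace K := hKc.completeSpace_coe
    rintro p hp
    let q := e (K.starProjection (e.symm p))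
    have hq : q ∈ T.graph.topologicalClosure := K.starProjection_apply_mem (e.symm p)
    have hr : (p.1 - q.1, p.2 - q.2) ∈ T.graph.adjoint :=
      T.graph.adjoint.sub_mem hp (hle hq)
    have hr' : (p.2 - q.2, -(p.1 - q.1)) ∈ T.graph.adjoint := by
      rw [Submodule.mem_adjoint_iff]
      intro a b hab
      have h := K.starProjection_inner_eq_zero (e.symm p) (e.symm (a, b))
        (T.graph.le_topologicalClosure hab)
      rw [WithLp.prod_inner_apply] at h
      have h' : ⟪p.1 - q.1, a⟫ + ⟪p.2 - q.2, b⟫ = 0 := h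
      have h'' := congrArg (starRingEnd ℂ) h'
      rw [_root_.map_add, inner_conj_symm, inner_conj_symm, _root_.map_zero] at h''
      simp only [inner_neg_right]
      linear_combination h''
    obtain ⟨z1, z2⟩ := hzero _ _ hr hr'
    have : p = q := Prod.ext (sub_eq_zero.mp z1) (sub_eq_zero.mp z2)
    rwa [this]
  apply eq_of_eq_graph
  rw [adjoint_graph_eq_graph_adjoint hcd, ← hgraph]
  apply le_antisymm
  · refine le_trans (fun x hx => ?_) hge
    rw [Submodule.mem_adjoint_iff] at hx ⊢
    exact fun a b hab => hx a b (T.graph.le_topologicalClosure hab)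
  · intro x hx
    have hcl : _root_.IsClosed {p : G × G | ⟪p.2, x.1⟫ - ⟪p.1, x.2⟫ = 0} :=
      isClosed_eq (by fun_prop) continuous_const
    rw [Submodule.mem_adjoint_iff]
    intro a b hab
    refine closure_minimal (fun p hp => ?_) hcl hab
    exact (Submodule.mem_adjoint_iff _ _).mp (hle hx) p.1 p.2 hp

end EssentialSelfAdjointness

section TensorProductOperators

variable {H₁ H₂ G : Type*}
  [NormedAddCommGroup H₁] [InnerProductSpace ℂ H₁]
  [NormedAddCommGroup H₂] [InnerProductSpace ℂ H₂]
  [NormedAddCommGroup G] [InnerProductSpace ℂ G]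
  {tm : H₁ →ₗ[ℂ] H₂ →ₗ[ℂ] G}

theorem exists_linearIsometry_tmul
    (hinner : ∀ (a c : H₁) (b d : H₂), ⟪tm a b, tm c d⟫ = ⟪a, c⟫ * ⟪b, d⟫) :
    ∃ J : H₁ ⊗[ℂ] H₂ →ₗᵢ[ℂ] G, ∀ a b, J (a ⊗ₜ b) = tm a b := by
  refine ⟨(TensorProduct.lift tm).isometryOfInner fun x y => ?_, fun a b => by simp⟩
  induction x with
  | zero => simp
  | add x x' hx hx' => simp only [map_add, inner_add_left, hx, hx']
  | tmul a b =>
    induction y with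
    | zero => simp
    | add y y' hy hy' => simp only [map_add, inner_add_right, hy, hy']
    | tmul c d => simp [hinner]

theorem continuous_uncurry_of_inner
    (hinner : ∀ (a c : H₁) (b d : H₂), ⟪tm a b, tm c d⟫ = ⟪a, c⟫ * ⟪b, d⟫) :
    Continuous fun p : H₁ × H₂ => tm p.1 p.2 := by
  obtain ⟨J, hJ⟩ := exists_linearIsometry_tmul hinner
  simp_rw [← hJ]
  exact J.continuous.comp TensorProduct.continuous_tmul

/-- Bounded operators on the factors induce a bounded operator on the Hilbert tensor product. -/
theorem exists_tensor_clm [CompleteSpace G]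
    (hinner : ∀ (a c : H₁) (b d : H₂), ⟪tm a b, tm c d⟫ = ⟪a, c⟫ * ⟪b, d⟫)
    (hdense : Dense (Submodule.span ℂ {z : G | ∃ a b, z = tm a b} : Set G))
    (f : H₁ →L[ℂ] H₁) (g : H₂ →L[ℂ] H₂) :
    ∃ P : G →L[ℂ] G, ∀ a b, P (tm a b) = tm (f a) (g b) := by
  obtain ⟨J, hJ⟩ := exists_linearIsometry_tmul hinner
  have hJd : DenseRange J := by
    refine hdense.mono ?_
    change _ ≤ LinearMap.range J.toLinearMap
    rw [Submodule.span_le]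
    rintro _ ⟨a, b, rfl⟩
    exact ⟨a ⊗ₜ b, hJ a b⟩
  refine ⟨(J.toContinuousLinearMap ∘L TensorProduct.mapL f g).extend J.toContinuousLinearMap,
    fun a b => ?_⟩
  have := ContinuousLinearMap.extend_eq (J.toContinuousLinearMap ∘L TensorProduct.mapL f g)
    (e := J.toContinuousLinearMap) hJd J.isometry.isUniformInducing (a ⊗ₜ b)
  simpa [hJ] using this

theorem eq_zero_of_inner_tensor_eq_zero
    (hdense : Dense (Submodule.span ℂ {z : G | ∃ a b, z = tm a b} : Set G)) {z : G}
    (h : ∀ a b, ⟪z, tm a b⟫ = 0) : z = 0 := by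
  refine hdense.eq_zero_of_inner_left ℂ fun v hv => ?_
  induction hv using Submodule.span_induction with
  | mem x hx => obtain ⟨a, b, rfl⟩ := hx; exact h a b
  | zero => simp
  | add x y _ _ hx hy => rw [inner_add_right, hx, hy, add_zero]
  | smul c x _ hx => rw [inner_smul_right, hx, mul_zero]

theorem clm_ext_on_tensors
    (hdense : Dense (Submodule.span ℂ {z : G | ∃ a b, z = tm a b} : Set G)) {P Q : G →L[ℂ] G}
    (h : ∀ a b, P (tm a b) = Q (tm a b)) : P = Q :=
  ContinuousLinearMap.ext_on hdense <| by rintro _ ⟨a, b, rfl⟩; exact h a b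

theorem isSymmetric_of_tensor [CompleteSpace G]
    (hinner : ∀ (a c : H₁) (b d : H₂), ⟪tm a b, tm c d⟫ = ⟪a, c⟫ * ⟪b, d⟫)
    (hdense : Dense (Submodule.span ℂ {z : G | ∃ a b, z = tm a b} : Set G))
    {f : H₁ →L[ℂ] H₁} {g : H₂ →L[ℂ] H₂} {P : G →L[ℂ] G}
    (hf : (f : H₁ →ₗ[ℂ] H₁).IsSymmetric) (hg : (g : H₂ →ₗ[ℂ] H₂).IsSymmetric)
    (hP : ∀ a b, P (tm a b) = tm (f a) (g b)) : (P : G →ₗ[ℂ] G).IsSymmetric := by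
  have hadj : ContinuousLinearMap.adjoint P = P := by
    refine clm_ext_on_tensors hdense fun a b => sub_eq_zero.mp ?_
    refine eq_zero_of_inner_tensor_eq_zero hdense fun c d => ?_
    have e1 : ⟪f a, c⟫ = ⟪a, f c⟫ := hf a c
    have e2 : ⟪g b, d⟫ = ⟪b, g d⟫ := hg b d
    rw [inner_sub_left, ContinuousLinearMap.adjoint_inner_left, hP, hP, hinner, hinner, e1, e2,
      sub_self]
  intro x y
  conv_lhs => rw [← hadj]
  exact ContinuousLinearMap.adjoint_inner_left P y x

theorem tensor_mem_closure
    (hinner : ∀ (a c : H₁) (b d : H₂), ⟪tm a b, tm c d⟫ = ⟪a, c⟫ * ⟪b, d⟫)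
    {s : Set H₁} {t : Set H₂} (hs : Dense s) (ht : Dense t) (a : H₁) (b : H₂) :
    tm a b ∈ closure {z : G | ∃ x ∈ s, ∃ y ∈ t, z = tm x y} :=
  map_mem_closure₂ (f := fun x y => tm x y) (continuous_uncurry_of_inner hinner) (hs a) (ht b)
    fun x hx y hy => ⟨x, hx, y, hy, rfl⟩

/-- If `D` and `D'` are symmetric and injective, then so is their tensor product. -/
theorem tensor_eq_zero_of_apply_eq_zero [CompleteSpace H₁] [CompleteSpace H₂]
    (hinner : ∀ (a c : H₁) (b d : H₂), ⟪tm a b, tm c d⟫ = ⟪a, c⟫ * ⟪b, d⟫)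
    (hdense : Dense (Submodule.span ℂ {z : G | ∃ a b, z = tm a b} : Set G))
    {f : H₁ →L[ℂ] H₁} {g : H₂ →L[ℂ] H₂} {Q : G →L[ℂ] G}
    (hf : (f : H₁ →ₗ[ℂ] H₁).IsSymmetric) (hg : (g : H₂ →ₗ[ℂ] H₂).IsSymmetric)
    (hf0 : ∀ x, f x = 0 → x = 0) (hg0 : ∀ x, g x = 0 → x = 0)
    (hQs : (Q : G →ₗ[ℂ] G).IsSymmetric)
    (hQ : ∀ a b, Q (tm a b) = tm (f a) (g b)) {z : G} (hz : Q z = 0) : z = 0 := by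
  refine eq_zero_of_inner_tensor_eq_zero hdense fun a b => ?_
  have hcl : IsClosed {v : G | ⟪z, v⟫ = 0} := isClosed_eq (by fun_prop) continuous_const
  refine closure_minimal ?_ hcl
    (tensor_mem_closure hinner (denseRange_of_isSymmetric hf hf0) (denseRange_of_isSymmetric hg hg0)
      a b)
  rintro _ ⟨_, ⟨x, rfl⟩, _, ⟨y, rfl⟩, rfl⟩
  have h : ⟪Q z, tm x y⟫ = ⟪z, Q (tm x y)⟫ := hQs z (tm x y)
  rw [hz, inner_zero_left, hQ] at h
  exact h.symm

end TensorProductOperators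

/-!
STATEMENT 15. For `i = 1, 2` let `Tᵢ` be an essentially selfadjoint operator in a complex
Hilbert space `Hᵢ` (densely defined, symmetric, with selfadjoint closure).  Then the algebraic
tensor product operator `T₁ ⊗̲ T₂`, with domain `Dom T₁ ⊗̲ Dom T₂` in the Hilbert space tensor
product `H₁ ⊗ H₂`, is essentially selfadjoint.

The Hilbert space tensor product is given abstractly: a Hilbert space `G` together with a
bilinear map `tm` whose inner products satisfy `⟪tm a b, tm c d⟫ = ⟪a,c⟫⟪b,d⟫` and whose range
spans a dense subspace.  The algebraic tensor product operator `T` is characterised by its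
graph: the (algebraic) span of the elementary pairs `(x ⊗ y, T₁ x ⊗ T₂ y)`.
-/
theorem stmt15 {H₁ H₂ G : Type*}
    [NormedAddCommGroup H₁] [InnerProductSpace ℂ H₁] [CompleteSpace H₁]
    [NormedAddCommGroup H₂] [InnerProductSpace ℂ H₂] [CompleteSpace H₂]
    [NormedAddCommGroup G] [InnerProductSpace ℂ G] [CompleteSpace G]
    (tm : H₁ →ₗ[ℂ] H₂ →ₗ[ℂ] G)
    (htm_inner : ∀ (a c : H₁) (b d : H₂), ⟪tm a b, tm c d⟫ = ⟪a, c⟫ * ⟪b, d⟫)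
    (htm_dense : Dense (Submodule.span ℂ {z : G | ∃ a b, z = tm a b} : Set G))
    (T₁ : H₁ →ₗ.[ℂ] H₁) (T₂ : H₂ →ₗ.[ℂ] H₂)
    (h₁dense : Dense (T₁.domain : Set H₁)) (h₂dense : Dense (T₂.domain : Set H₂))
    (h₁sym : ∀ x y : T₁.domain, ⟪T₁ x, (y : H₁)⟫ = ⟪(x : H₁), T₁ y⟫)
    (h₂sym : ∀ x y : T₂.domain, ⟪T₂ x, (y : H₂)⟫ = ⟪(x : H₂), T₂ y⟫)
    (h₁sa : T₁.closure.adjoint = T₁.closure) (h₂sa : T₂.closure.adjoint = T₂.closure)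
    (T : G →ₗ.[ℂ] G)
    (hT : T.graph = Submodule.span ℂ
      {p : G × G | ∃ (x : T₁.domain) (y : T₂.domain),
        p = (tm (x : H₁) (y : H₂), tm (T₁ x) (T₂ y))}) :
    Dense (T.domain : Set G) ∧
    (∀ x y : T.domain, ⟪T x, (y : G)⟫ = ⟪(x : G), T y⟫) ∧
    T.closure.adjoint = T.closure := by
  obtain ⟨hd, hsym⟩ : Dense (T.domain : Set G) ∧ T.IsFormalAdjoint T := by
    have hmem : ∀ (x : T₁.domain) (y : T₂.domain),
        (tm (x : H₁) (y : H₂), tm (T₁ x) (T₂ y)) ∈ T.graph := fun x y => by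
      rw [hT]
      exact Submodule.subset_span ⟨x, y, rfl⟩
    constructor
    · refine dense_closure.mp (htm_dense.mono ?_)
      change _ ≤ T.domain.topologicalClosure
      rw [Submodule.span_le]
      rintro _ ⟨a, b, rfl⟩
      refine closure_mono ?_ (tensor_mem_closure htm_inner h₁dense h₂dense a b)
      rintro _ ⟨x, hx, y, hy, rfl⟩
      exact LinearPMap.mem_domain_of_mem_graph (hmem ⟨x, hx⟩ ⟨y, hy⟩)
    · have key : ∀ p ∈ T.graph, ∀ q ∈ T.graph, ⟪p.2, q.1⟫ = ⟪p.1, q.2⟫ := by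
        rw [hT]
        intro p hp q hq
        induction hp, hq using Submodule.span_induction₂ with
        | mem_mem p q hp hq =>
          obtain ⟨x, y, rfl⟩ := hp
          obtain ⟨x', y', rfl⟩ := hq
          simp only [htm_inner, h₁sym, h₂sym]
        | zero_left => simp
        | zero_right => simp
        | add_left _ _ _ _ _ _ h h' => simp [h, h']
        | add_right _ _ _ _ _ _ h h' => simp [h, h']
        | smul_left _ _ _ _ _ h => simp [h]
        | smul_right _ _ _ _ _ h => simp [h]
      exact fun x y => key _ (T.mem_graph x) _ (T.mem_graph y)
  refine ⟨hd, fun x y => hsym x y, ?_⟩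
  obtain ⟨C₁, D₁, hC₁, hD₁, hCD₁, hD₁0, hg₁⟩ :=
    exists_bounded_pair_of_isSelfAdjoint (LinearPMap.isSelfAdjoint_def.mpr h₁sa)
  obtain ⟨C₂, D₂, hC₂, hD₂, hCD₂, hD₂0, hg₂⟩ :=
    exists_bounded_pair_of_isSelfAdjoint (LinearPMap.isSelfAdjoint_def.mpr h₂sa)
  obtain ⟨P, hP⟩ := exists_tensor_clm htm_inner htm_dense C₁ C₂
  obtain ⟨Q, hQ⟩ := exists_tensor_clm htm_inner htm_dense D₁ D₂
  have hPs := isSymmetric_of_tensor htm_inner htm_dense hC₁ hC₂ hP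
  have hQs := isSymmetric_of_tensor htm_inner htm_dense hD₁ hD₂ hQ
  rw [← (LinearPMap.isClosable_of_isFormalAdjoint h₁dense
    fun x y => h₁sym x y).graph_closure_eq_closure_graph] at hg₁
  rw [← (LinearPMap.isClosable_of_isFormalAdjoint h₂dense
    fun x y => h₂sym x y).graph_closure_eq_closure_graph] at hg₂
  have hPQ : P ∘L Q = Q ∘L P := clm_ext_on_tensors htm_dense fun a b => by
    simp [hP, hQ, hCD₁, hCD₂]
  have hcl : ∀ a b, (tm (D₁ a) (D₂ b), tm (C₁ a) (C₂ b)) ∈ closure (T.graph : Set (G × G)) := by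
    intro a b
    have hc := continuous_uncurry_of_inner htm_inner
    refine map_mem_closure₂ (f := fun (p : H₁ × H₁) (q : H₂ × H₂) => (tm p.1 q.1, tm p.2 q.2))
      ?_ (hg₁ a) (hg₂ b) ?_
    · exact (hc.comp (f := fun r : (H₁ × H₁) × (H₂ × H₂) => (r.1.1, r.2.1)) (by fun_prop)).prodMk
        (hc.comp (f := fun r : (H₁ × H₁) × (H₂ × H₂) => (r.1.2, r.2.2)) (by fun_prop))
    · rintro p hp q hq
      obtain ⟨x, rfl⟩ := (LinearPMap.mem_graph_iff' _).mp hp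
      obtain ⟨y, rfl⟩ := (LinearPMap.mem_graph_iff' _).mp hq
      rw [hT]
      exact Submodule.subset_span ⟨x, y, rfl⟩
  refine LinearPMap.adjoint_closure_eq_closure_of_commuting_pair hd hsym P Q hPs hQs
    (fun z => DFunLike.congr_fun hPQ z)
    (fun z => tensor_eq_zero_of_apply_eq_zero htm_inner htm_dense hD₁ hD₂ hD₁0 hD₂0 hQs hQ)
    fun w w' hw => sub_eq_zero.mp (eq_zero_of_inner_tensor_eq_zero htm_dense fun a b => ?_)
  have hclosed : IsClosed {p : G × G | ⟪w, p.2⟫ = ⟪w', p.1⟫} :=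
    isClosed_eq (by fun_prop) (by fun_prop)
  have h : ⟪w, tm (C₁ a) (C₂ b)⟫ = ⟪w', tm (D₁ a) (D₂ b)⟫ := by
    refine closure_minimal (fun p hp => ?_) hclosed (hcl a b)
    have h := congrArg (starRingEnd ℂ) ((Submodule.mem_adjoint_iff _ _).mp hw p.1 p.2 hp)
    rw [map_sub, inner_conj_symm, inner_conj_symm, map_zero] at h
    exact sub_eq_zero.mp h
  have e1 : ⟪P w, tm a b⟫ = ⟪w, P (tm a b)⟫ := hPs w (tm a b)
  have e2 : ⟪Q w', tm a b⟫ = ⟪w', Q (tm a b)⟫ := hQs w' (tm a b)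
  rw [inner_sub_left, e1, e2, hP, hQ, h, sub_self]
end

section
/- For i = 1, 2, let T_i be a closed, densely defined linear operator from a Hilbert space H_i′ to a Hilbert space H_i″, and let B_i be a bounded, everywhere-defined linear operator from a Hilbert space H_i to H_i′, and suppose that T₁B₁ and T₂B₂ are densely defined. Then (T₁ ⊗ T₂)(B₁ ⊗ B₂) = (T₁B₁) ⊗ (T₂B₂), where for closed densely defined operators S₁, S₂ the symbol S₁ ⊗ S₂ denotes the closure of the algebraic tensor product operator, and B₁ ⊗ B₂ is the bounded tensor product (note that T_iB_i is closed). -/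
open scoped ComplexInnerProductSpace

open scoped TensorProduct InnerProduct

section ProductSubmodules

variable {E F : Type*}
  [NormedAddCommGroup E] [InnerProductSpace ℂ E]
  [NormedAddCommGroup F] [InnerProductSpace ℂ F]

/-- A subspace of `E × F` seen inside the Hilbert space direct sum of `E` and `F`. -/
def Submodule.toL2Prod (K : Submodule ℂ (E × F)) : Submodule ℂ (WithLp 2 (E × F)) :=
  K.comap (WithLp.linearEquiv 2 ℂ (E × F)).toLinearMap

variable [CompleteSpace E] [CompleteSpace F]

theorem Submodule.hasOrthogonalProjection_toL2Prod {K : Submodule ℂ (E × F)}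
    (hK : IsClosed (K : Set (E × F))) : K.toL2Prod.HasOrthogonalProjection := by
  have hcl : IsClosed (K.toL2Prod : Set (WithLp 2 (E × F))) :=
    hK.preimage (WithLp.prod_continuous_ofLp 2 E F)
  have : CompleteSpace K.toL2Prod := hcl.completeSpace_coe
  infer_instance

theorem Submodule.exists_mem_topologicalClosure_sub_orthogonal (K : Submodule ℂ (E × F))
    (p : E × F) : ∃ q ∈ K.topologicalClosure, ∀ k ∈ K.topologicalClosure,
      ⟪k.1, p.1 - q.1⟫ + ⟪k.2, p.2 - q.2⟫ = 0 := by
  have := hasOrthogonalProjection_toL2Prod K.isClosed_topologicalClosure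
  set U := K.topologicalClosure.toL2Prod with hU
  let z : WithLp 2 (E × F) := WithLp.toLp 2 p
  refine ⟨WithLp.ofLp (U.starProjection z), U.starProjection_apply_mem z, fun k hk => ?_⟩
  have h := Submodule.inner_right_of_mem_orthogonal (K := U) (u := WithLp.toLp 2 k) (by exact hk)
    (U.sub_starProjection_mem_orthogonal z)
  rwa [WithLp.prod_inner_apply] at h

/-- A point on which every functional vanishing on `K` vanishes lies in the closure of `K`. -/
theorem Submodule.mem_topologicalClosure_of_inner_eq_zero (K : Submodule ℂ (E × F)) (p : E × F)
    (h : ∀ c d, (∀ k ∈ K, ⟪k.1, c⟫ + ⟪k.2, d⟫ = 0) → ⟪p.1, c⟫ + ⟪p.2, d⟫ = 0) :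
    p ∈ K.topologicalClosure := by
  obtain ⟨q, hq, hort⟩ := K.exists_mem_topologicalClosure_sub_orthogonal p
  have h1 := h _ _ fun k hk => hort k (K.le_topologicalClosure hk)
  have h2 := hort q hq
  have h3 : ⟪p.1 - q.1, p.1 - q.1⟫ + ⟪p.2 - q.2, p.2 - q.2⟫ = 0 := by
    rw [inner_sub_left (p.1) (q.1) (p.1 - q.1), inner_sub_left (p.2) (q.2) (p.2 - q.2)]
    linear_combination h1 - h2
  have h4 : ‖p.1 - q.1‖ ^ 2 + ‖p.2 - q.2‖ ^ 2 = 0 := by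
    rw [inner_self_eq_norm_sq_to_K, inner_self_eq_norm_sq_to_K] at h3
    exact Complex.ofReal_injective (by simpa using h3)
  have h5 : p = q := by
    refine Prod.ext ?_ ?_ <;> rw [← sub_eq_zero, ← norm_eq_zero] <;>
      nlinarith [sq_nonneg ‖p.1 - q.1‖, sq_nonneg ‖p.2 - q.2‖]
  exact h5 ▸ hq

theorem Submodule.mem_of_orthogonal_adjoint {Γ : Submodule ℂ (E × F)}
    (hΓ : IsClosed (Γ : Set (E × F))) (p : E × F)
    (h : ∀ us ∈ Γ.adjoint, ⟪p.1, us.2⟫ = ⟪p.2, us.1⟫) : p ∈ Γ := by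
  rw [← hΓ.submodule_topologicalClosure_eq]
  refine Γ.mem_topologicalClosure_of_inner_eq_zero p fun c d hcd => ?_
  have := h (-d, c) <| by
    rw [mem_adjoint_iff]
    intro a b hab
    rw [inner_neg_right]
    linear_combination -hcd _ hab
  rw [this, inner_neg_right]
  ring

/-- The adjoint of a closed operator is densely defined. -/
theorem Submodule.dense_map_fst_adjoint {Γ : Submodule ℂ (E × F)}
    (hΓ : IsClosed (Γ : Set (E × F))) (hgraph : ∀ b, ((0 : E), b) ∈ Γ → b = 0) :
    Dense (Γ.adjoint.map (LinearMap.fst ℂ F E) : Set F) := by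
  rw [Submodule.dense_iff_topologicalClosure_eq_top, Submodule.topologicalClosure_eq_top_iff,
    Submodule.eq_bot_iff]
  intro b hb
  refine hgraph b (mem_of_orthogonal_adjoint hΓ _ fun us hus => ?_)
  rw [Submodule.mem_orthogonal'] at hb
  simp [hb us.1 ⟨us, hus, rfl⟩]

/-- With `R = C† C = (1 + S† S)⁻¹` for the operator `S` with graph `Γ`, the operators `1 - R` and
`S† S R` agree, and `1 - R` is again of the form `D† D`. -/
theorem Submodule.exists_resolvent {Γ : Submodule ℂ (E × F)}
    (hΓ : IsClosed (Γ : Set (E × F))) (hdense : Dense (Γ.map (LinearMap.fst ℂ E F) : Set E)) :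
    ∃ C D : E →L[ℂ] WithLp 2 (E × F), DenseRange (fun p => (C†) (C p)) ∧
      ∀ p, (C†) (C p) + (D†) (D p) = p ∧
        ∃ s, ((C†) (C p), s) ∈ Γ ∧ (s, (D†) (D p)) ∈ Γ.adjoint := by
  have := hasOrthogonalProjection_toL2Prod hΓ
  set U := Γ.toL2Prod with hU
  let V : E →L[ℂ] WithLp 2 (E × F) :=
    (WithLp.prodContinuousLinearEquiv 2 ℂ E F).symm.toContinuousLinearMap ∘L
      ContinuousLinearMap.inl ℂ E F
  have hV (a : E) : V a = WithLp.toLp 2 (a, 0) := rfl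
  have hVadj (z : WithLp 2 (E × F)) : (V†) z = z.fst := by
    refine ext_inner_right ℂ fun a => ?_
    rw [ContinuousLinearMap.adjoint_inner_left, hV]
    simp [WithLp.prod_inner_apply]
  have hC (p : E) : ((U.starProjection ∘L V)†) ((U.starProjection ∘L V) p)
      = (U.starProjection (V p)).fst := by
    rw [ContinuousLinearMap.adjoint_comp, ContinuousLinearMap.comp_apply,
      ContinuousLinearMap.comp_apply, hVadj,
      (ContinuousLinearMap.isSelfAdjoint_iff'.mp (isSelfAdjoint_starProjection U)),
      U.starProjection_eq_self_iff.mpr (U.starProjection_apply_mem _)]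
  have hD (p : E) : ((Uᗮ.starProjection ∘L V)†) ((Uᗮ.starProjection ∘L V) p)
      = (Uᗮ.starProjection (V p)).fst := by
    rw [ContinuousLinearMap.adjoint_comp, ContinuousLinearMap.comp_apply,
      ContinuousLinearMap.comp_apply, hVadj,
      (ContinuousLinearMap.isSelfAdjoint_iff'.mp (isSelfAdjoint_starProjection Uᗮ)),
      Uᗮ.starProjection_eq_self_iff.mpr (Uᗮ.starProjection_apply_mem _)]
  refine ⟨U.starProjection ∘L V, Uᗮ.starProjection ∘L V, ?_, fun p => ?_⟩
  · have hr : Set.range (fun p => ((U.starProjection ∘L V)†) ((U.starProjection ∘L V) p)) =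
        (((U.starProjection ∘L V)† ∘L (U.starProjection ∘L V)).range : Set E) := by
      ext; simp
    rw [DenseRange, hr, Submodule.dense_iff_topologicalClosure_eq_top,
      Submodule.topologicalClosure_eq_top_iff, Submodule.eq_bot_iff]
    intro y hy
    have h0 : ⟪(U.starProjection ∘L V) y, (U.starProjection ∘L V) y⟫ = 0 := by
      rw [← ContinuousLinearMap.adjoint_inner_left]
      exact Submodule.inner_right_of_mem_orthogonal (LinearMap.mem_range_self _ y) hy
    have h1 : V y ∈ Uᗮ := by
      rw [← U.starProjection_apply_eq_zero_iff]
      exact inner_self_eq_zero.mp h0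
    refine hdense.eq_zero_of_inner_left ℂ ?_
    rintro _ ⟨⟨a, b⟩, hab, rfl⟩
    have := Submodule.inner_left_of_mem_orthogonal (K := U) (u := WithLp.toLp 2 (a, b))
      (by exact hab) h1
    simpa [hV, WithLp.prod_inner_apply] using this
  · rw [hC, hD]
    have hsum : U.starProjection (V p) + Uᗮ.starProjection (V p) = V p :=
      U.starProjection_add_starProjection_orthogonal _
    refine ⟨congrArg WithLp.fst hsum, (U.starProjection (V p)).snd,
      U.starProjection_apply_mem (V p), ?_⟩
    rw [mem_adjoint_iff]
    intro a b hab
    have h := Submodule.inner_right_of_mem_orthogonal (K := U) (u := WithLp.toLp 2 (a, b))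
      (by exact hab) (Uᗮ.starProjection_apply_mem (V p))
    have hsnd : (U.starProjection (V p)).snd + (Uᗮ.starProjection (V p)).snd = 0 :=
      congrArg WithLp.snd hsum
    rw [eq_neg_of_add_eq_zero_left hsnd, inner_neg_right, ← neg_eq_zero]
    rw [WithLp.prod_inner_apply] at h
    change ⟪a, (Uᗮ.starProjection (V p)).fst⟫ + ⟪b, (Uᗮ.starProjection (V p)).snd⟫ = 0 at h
    linear_combination h

end ProductSubmodules

section TensorProducts

variable {E₁ E₂ G : Type*}
  [NormedAddCommGroup E₁] [InnerProductSpace ℂ E₁]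
  [NormedAddCommGroup E₂] [InnerProductSpace ℂ E₂]
  [NormedAddCommGroup G] [InnerProductSpace ℂ G]
  {tm : E₁ →ₗ[ℂ] E₂ →ₗ[ℂ] G}

theorem norm_tensor_apply (htm : ∀ a c b d, ⟪tm a b, tm c d⟫ = ⟪a, c⟫ * ⟪b, d⟫) (a : E₁) (b : E₂) :
    ‖tm a b‖ = ‖a‖ * ‖b‖ := by
  have h := htm a a b b
  simp only [inner_self_eq_norm_sq_to_K] at h
  have h' : ‖tm a b‖ ^ 2 = (‖a‖ * ‖b‖) ^ 2 := by
    rw [mul_pow]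
    exact_mod_cast h
  exact (sq_eq_sq₀ (norm_nonneg _) (by positivity)).mp h'

theorem continuous_tensor_left (htm : ∀ a c b d, ⟪tm a b, tm c d⟫ = ⟪a, c⟫ * ⟪b, d⟫) (b : E₂) :
    Continuous fun a => tm a b :=
  AddMonoidHomClass.continuous_of_bound (tm.flip b) ‖b‖ fun a => by
    rw [LinearMap.flip_apply, norm_tensor_apply htm, mul_comm]

theorem continuous_tensor_right (htm : ∀ a c b d, ⟪tm a b, tm c d⟫ = ⟪a, c⟫ * ⟪b, d⟫) (a : E₁) :
    Continuous fun b => tm a b :=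
  AddMonoidHomClass.continuous_of_bound (tm a) ‖a‖ fun b => (norm_tensor_apply htm a b).le

theorem eq_zero_of_inner_tensor_eq_zero_s16
    (htm : ∀ a c b d, ⟪tm a b, tm c d⟫ = ⟪a, c⟫ * ⟪b, d⟫)
    (htm_dense : Dense (Submodule.span ℂ {z : G | ∃ a b, z = tm a b} : Set G))
    {s : Set E₁} {t : Set E₂} (hs : Dense s) (ht : Dense t) {x : G}
    (hx : ∀ a ∈ s, ∀ b ∈ t, ⟪x, tm a b⟫ = 0) : x = 0 := by
  have h1 (a : E₁) (ha : a ∈ s) (b : E₂) : ⟪x, tm a b⟫ = 0 :=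
    congrFun ((continuous_const.inner (continuous_tensor_right htm a)).ext_on ht
      continuous_const (fun b hb => hx a ha b hb)) b
  have h2 (a : E₁) (b : E₂) : ⟪x, tm a b⟫ = 0 :=
    congrFun ((continuous_const.inner (continuous_tensor_left htm b)).ext_on hs
      continuous_const (fun a ha => h1 a ha b)) a
  refine htm_dense.eq_zero_of_inner_left ℂ fun v hv => ?_
  induction hv using Submodule.span_induction with
  | mem v hv => obtain ⟨a, b, rfl⟩ := hv; exact h2 a b
  | zero => exact inner_zero_right _
  | add v w _ _ hv hw => rw [inner_add_right, hv, hw, add_zero]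
  | smul c v _ hv => rw [inner_smul_right, hv, mul_zero]

/-- For a bounded operator `C` on a tensor product, an identity `⟪k, C x⟫ = ⟪y, x⟫` holds everywhere
once it holds on elementary tensors. -/
theorem inner_eq_of_inner_tensor_eq {X : Type*} [NormedAddCommGroup X] [InnerProductSpace ℂ X]
    (htm_dense : Dense (Submodule.span ℂ {z : G | ∃ a b, z = tm a b} : Set G))
    (C : G →L[ℂ] X) {k : X} {y : G} (h : ∀ a b, ⟪k, C (tm a b)⟫ = ⟪y, tm a b⟫) (x : G) :
    ⟪k, C x⟫ = ⟪y, x⟫ := by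
  have : innerSL ℂ k ∘L C = innerSL ℂ y :=
    ContinuousLinearMap.ext_on htm_dense (by rintro _ ⟨a, b, rfl⟩; simpa using h a b)
  simpa using congrArg (fun f => f x) this

theorem exists_tensor_map {K₁ K₂ : Type*}
    [NormedAddCommGroup K₁] [InnerProductSpace ℂ K₁]
    [NormedAddCommGroup K₂] [InnerProductSpace ℂ K₂]
    (htm : ∀ a c b d, ⟪tm a b, tm c d⟫ = ⟪a, c⟫ * ⟪b, d⟫)
    (htm_dense : Dense (Submodule.span ℂ {z : G | ∃ a b, z = tm a b} : Set G))
    (C₁ : E₁ →L[ℂ] K₁) (C₂ : E₂ →L[ℂ] K₂) :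
    ∃ C : G →L[ℂ] UniformSpace.Completion (K₁ ⊗[ℂ] K₂),
      ∀ p q, C (tm p q) = ((C₁ p ⊗ₜ[ℂ] C₂ q : K₁ ⊗[ℂ] K₂) :
        UniformSpace.Completion (K₁ ⊗[ℂ] K₂)) := by
  let e : E₁ ⊗[ℂ] E₂ →ₗ[ℂ] G := TensorProduct.lift tm
  have he_inner (y z : E₁ ⊗[ℂ] E₂) : ⟪e y, e z⟫ = ⟪y, z⟫ := by
    induction y using TensorProduct.induction_on with
    | zero => simp
    | add y y' hy hy' => rw [map_add, inner_add_left, inner_add_left, hy, hy']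
    | tmul a b =>
      induction z using TensorProduct.induction_on with
      | zero => simp
      | add z z' hz hz' => rw [map_add, inner_add_right, inner_add_right, hz, hz']
      | tmul c d => simp [e, htm]
  have he_norm (z : E₁ ⊗[ℂ] E₂) : ‖e z‖ = ‖z‖ := by
    rw [@norm_eq_sqrt_re_inner ℂ, @norm_eq_sqrt_re_inner ℂ, he_inner]
  have he_dense : DenseRange e := by
    refine htm_dense.mono ?_
    rw [← LinearMap.coe_range, SetLike.coe_subset_coe, Submodule.span_le]
    rintro _ ⟨a, b, rfl⟩
    exact ⟨a ⊗ₜ b, by simp [e]⟩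
  let f : E₁ ⊗[ℂ] E₂ →ₗ[ℂ] UniformSpace.Completion (K₁ ⊗[ℂ] K₂) :=
    (UniformSpace.Completion.toComplL (𝕜 := ℂ) (E := K₁ ⊗[ℂ] K₂) ∘L
      TensorProduct.mapL C₁ C₂).toLinearMap
  refine ⟨f.extendOfNorm e, fun p q => ?_⟩
  have h := LinearMap.extendOfNorm_eq (f := f) he_dense
    ⟨‖TensorProduct.mapL C₁ C₂‖, fun z => ?_⟩ (p ⊗ₜ[ℂ] q)
  · simpa [e, f] using h
  · rw [he_norm]
    simpa [f] using (TensorProduct.mapL C₁ C₂).le_opNorm z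

end TensorProducts

section GraphTensor

variable {E₁ E₂ F₁ F₂ GE GF : Type*}
  [NormedAddCommGroup E₁] [InnerProductSpace ℂ E₁]
  [NormedAddCommGroup E₂] [InnerProductSpace ℂ E₂]
  [NormedAddCommGroup F₁] [InnerProductSpace ℂ F₁]
  [NormedAddCommGroup F₂] [InnerProductSpace ℂ F₂]
  [NormedAddCommGroup GE] [InnerProductSpace ℂ GE]
  [NormedAddCommGroup GF] [InnerProductSpace ℂ GF]
  {tmE : E₁ →ₗ[ℂ] E₂ →ₗ[ℂ] GE} {tmF : F₁ →ₗ[ℂ] F₂ →ₗ[ℂ] GF}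
  {Γ₁ : Submodule ℂ (E₁ × F₁)} {Γ₂ : Submodule ℂ (E₂ × F₂)}

/-- The graph of the algebraic tensor product of the operators with graphs `Γ₁` and `Γ₂`. -/
def graphTensor (tmE : E₁ →ₗ[ℂ] E₂ →ₗ[ℂ] GE) (tmF : F₁ →ₗ[ℂ] F₂ →ₗ[ℂ] GF)
    (Γ₁ : Submodule ℂ (E₁ × F₁)) (Γ₂ : Submodule ℂ (E₂ × F₂)) : Submodule ℂ (GE × GF) :=
  Submodule.span ℂ {p | ∃ k ∈ Γ₁, ∃ l ∈ Γ₂, p = (tmE k.1 l.1, tmF k.2 l.2)}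

theorem tensor_mem_graphTensor {k : E₁ × F₁} (hk : k ∈ Γ₁) {l : E₂ × F₂} (hl : l ∈ Γ₂) :
    (tmE k.1 l.1, tmF k.2 l.2) ∈ graphTensor tmE tmF Γ₁ Γ₂ :=
  Submodule.subset_span ⟨k, hk, l, hl, rfl⟩

/-- The tensor product of the adjoints is contained in the adjoint of the tensor product. -/
theorem inner_tensor_adjoint_of_mem_closure
    (htmE : ∀ a c b d, ⟪tmE a b, tmE c d⟫ = ⟪a, c⟫ * ⟪b, d⟫)
    (htmF : ∀ a c b d, ⟪tmF a b, tmF c d⟫ = ⟪a, c⟫ * ⟪b, d⟫)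
    {q : GE × GF} (hq : q ∈ (graphTensor tmE tmF Γ₁ Γ₂).topologicalClosure)
    {us : F₁ × E₁} (hus : us ∈ Γ₁.adjoint) {vt : F₂ × E₂} (hvt : vt ∈ Γ₂.adjoint) :
    ⟪tmE us.2 vt.2, q.1⟫ = ⟪tmF us.1 vt.1, q.2⟫ := by
  let f : GE × GF →L[ℂ] ℂ := innerSL ℂ (tmE us.2 vt.2) ∘L ContinuousLinearMap.fst ℂ GE GF
  let g : GE × GF →L[ℂ] ℂ := innerSL ℂ (tmF us.1 vt.1) ∘L ContinuousLinearMap.snd ℂ GE GF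
  have hle : graphTensor tmE tmF Γ₁ Γ₂ ≤ LinearMap.eqLocus f.toLinearMap g.toLinearMap := by
    rw [graphTensor, Submodule.span_le]
    rintro _ ⟨k, hk, l, hl, rfl⟩
    have h1 : ⟪us.1, k.2⟫ = ⟪us.2, k.1⟫ := by
      rw [← inner_conj_symm, sub_eq_zero.mp ((Γ₁.mem_adjoint_iff us).mp hus k.1 k.2 hk),
        inner_conj_symm]
    have h2 : ⟪vt.1, l.2⟫ = ⟪vt.2, l.1⟫ := by
      rw [← inner_conj_symm, sub_eq_zero.mp ((Γ₂.mem_adjoint_iff vt).mp hvt l.1 l.2 hl),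
        inner_conj_symm]
    simp [f, g, htmE, htmF, h1, h2]
  exact Submodule.topologicalClosure_minimal _ hle (isClosed_eq f.continuous g.continuous) hq

/-- The weak identity for a tensor product extends from subspaces to their closures. -/
theorem inner_tensor_eq_of_mem_closure
    (htmE : ∀ a c b d, ⟪tmE a b, tmE c d⟫ = ⟪a, c⟫ * ⟪b, d⟫)
    (htmF : ∀ a c b d, ⟪tmF a b, tmF c d⟫ = ⟪a, c⟫ * ⟪b, d⟫)
    {A₁ : Submodule ℂ (F₁ × E₁)} {A₂ : Submodule ℂ (F₂ × E₂)} {p : GE × GF}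
    (hp : ∀ us ∈ A₁, ∀ vt ∈ A₂, ⟪tmE us.2 vt.2, p.1⟫ = ⟪tmF us.1 vt.1, p.2⟫) :
    ∀ us ∈ A₁.topologicalClosure, ∀ vt ∈ A₂.topologicalClosure,
      ⟪tmE us.2 vt.2, p.1⟫ = ⟪tmF us.1 vt.1, p.2⟫ := by
  have h₁ : ∀ us ∈ A₁, ∀ vt ∈ A₂.topologicalClosure,
      ⟪tmE us.2 vt.2, p.1⟫ = ⟪tmF us.1 vt.1, p.2⟫ := fun us hus vt hvt =>
    closure_minimal (hp us hus) (isClosed_eq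
      (((continuous_tensor_right htmE us.2).comp continuous_snd).inner continuous_const)
      (((continuous_tensor_right htmF us.1).comp continuous_fst).inner continuous_const)) hvt
  exact fun us hus vt hvt =>
    closure_minimal (fun us hus => h₁ us hus vt hvt) (isClosed_eq
      (((continuous_tensor_left htmE vt.2).comp continuous_snd).inner continuous_const)
      (((continuous_tensor_left htmF vt.1).comp continuous_fst).inner continuous_const)) hus

theorem graphTensor_graph (S₁ : E₁ →ₗ.[ℂ] F₁) (S₂ : E₂ →ₗ.[ℂ] F₂) :
    graphTensor tmE tmF S₁.graph S₂.graph = Submodule.span ℂ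
      {p : GE × GF | ∃ (x : S₁.domain) (y : S₂.domain),
        p = (tmE (x : E₁) (y : E₂), tmF (S₁ x) (S₂ y))} := by
  refine congrArg (Submodule.span ℂ) (Set.ext fun p => ⟨?_, ?_⟩)
  · rintro ⟨k, hk, l, hl, rfl⟩
    obtain ⟨x, hx, hx'⟩ := S₁.mem_graph_iff.mp hk
    obtain ⟨y, hy, hy'⟩ := S₂.mem_graph_iff.mp hl
    exact ⟨x, y, by rw [hx, hx', hy, hy']⟩
  · rintro ⟨x, y, rfl⟩
    exact ⟨_, S₁.mem_graph x, _, S₂.mem_graph y, rfl⟩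

variable [CompleteSpace E₁] [CompleteSpace E₂]

/-- A vector orthogonal to the range of `R₁ ⊗ R₂ + (1 - R₁) ⊗ (1 - R₂)` vanishes. -/
theorem eq_zero_of_inner_resolvent_tensor {K₁ K₂ : Type*}
    [NormedAddCommGroup K₁] [InnerProductSpace ℂ K₁] [CompleteSpace K₁]
    [NormedAddCommGroup K₂] [InnerProductSpace ℂ K₂] [CompleteSpace K₂]
    (htmE : ∀ a c b d, ⟪tmE a b, tmE c d⟫ = ⟪a, c⟫ * ⟪b, d⟫)
    (htmE_dense : Dense (Submodule.span ℂ {z : GE | ∃ a b, z = tmE a b} : Set GE))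
    (C₁ D₁ : E₁ →L[ℂ] K₁) (C₂ D₂ : E₂ →L[ℂ] K₂)
    (hC₁ : DenseRange fun p => (C₁†) (C₁ p)) (hC₂ : DenseRange fun p => (C₂†) (C₂ p))
    {x : GE} (hx : ∀ p q, ⟪tmE ((C₁†) (C₁ p)) ((C₂†) (C₂ q)), x⟫ +
      ⟪tmE ((D₁†) (D₁ p)) ((D₂†) (D₂ q)), x⟫ = 0) : x = 0 := by
  have key (A₁ : E₁ →L[ℂ] K₁) (A₂ : E₂ →L[ℂ] K₂) :
      ∃ A : GE →L[ℂ] UniformSpace.Completion (K₁ ⊗[ℂ] K₂),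
        ∀ p q y, ⟪A (tmE p q), A y⟫ = ⟪tmE ((A₁†) (A₁ p)) ((A₂†) (A₂ q)), y⟫ := by
    obtain ⟨A, hA⟩ := exists_tensor_map htmE htmE_dense A₁ A₂
    refine ⟨A, fun p q => inner_eq_of_inner_tensor_eq htmE_dense A fun a b => ?_⟩
    rw [hA, hA, UniformSpace.Completion.inner_coe, TensorProduct.inner_tmul, htmE,
      ContinuousLinearMap.adjoint_inner_left, ContinuousLinearMap.adjoint_inner_left]
  obtain ⟨C, hC⟩ := key C₁ C₂
  obtain ⟨D, hD⟩ := key D₁ D₂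
  have hsum : innerSL ℂ (C x) ∘L C + innerSL ℂ (D x) ∘L D = 0 := by
    refine ContinuousLinearMap.ext_on htmE_dense ?_
    rintro _ ⟨p, q, rfl⟩
    have h := hx p q
    rw [← hC, ← hD] at h
    simpa using congrArg (starRingEnd ℂ) h
  have hsq : ‖C x‖ ^ 2 + ‖D x‖ ^ 2 = 0 := by
    have h : ⟪C x, C x⟫ + ⟪D x, D x⟫ = 0 := congrArg (fun f => f x) hsum
    rw [inner_self_eq_norm_sq_to_K, inner_self_eq_norm_sq_to_K] at h
    exact Complex.ofReal_injective (by simpa using h)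
  have hCx : C x = 0 := by
    rw [← norm_eq_zero]
    nlinarith [sq_nonneg ‖C x‖, sq_nonneg ‖D x‖]
  refine eq_zero_of_inner_tensor_eq_zero_s16 htmE htmE_dense hC₁ hC₂ ?_
  rintro _ ⟨p, rfl⟩ _ ⟨q, rfl⟩
  rw [← inner_conj_symm, ← hC, hCx, inner_zero_right, map_zero]

/-- The adjoint of the tensor product of the adjoints of two closed densely defined operators is
contained in the closure of their algebraic tensor product. -/
theorem mem_closure_graphTensor_of_inner_tensor_adjoint [CompleteSpace F₁] [CompleteSpace F₂]
    [CompleteSpace GE] [CompleteSpace GF]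
    (htmE : ∀ a c b d, ⟪tmE a b, tmE c d⟫ = ⟪a, c⟫ * ⟪b, d⟫)
    (htmE_dense : Dense (Submodule.span ℂ {z : GE | ∃ a b, z = tmE a b} : Set GE))
    (htmF : ∀ a c b d, ⟪tmF a b, tmF c d⟫ = ⟪a, c⟫ * ⟪b, d⟫)
    (htmF_dense : Dense (Submodule.span ℂ {z : GF | ∃ a b, z = tmF a b} : Set GF))
    (hΓ₁ : IsClosed (Γ₁ : Set (E₁ × F₁))) (hΓ₂ : IsClosed (Γ₂ : Set (E₂ × F₂)))
    (hdense₁ : Dense (Γ₁.map (LinearMap.fst ℂ E₁ F₁) : Set E₁))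
    (hdense₂ : Dense (Γ₂.map (LinearMap.fst ℂ E₂ F₂) : Set E₂))
    (hgraph₁ : ∀ b, ((0 : E₁), b) ∈ Γ₁ → b = 0) (hgraph₂ : ∀ b, ((0 : E₂), b) ∈ Γ₂ → b = 0)
    {p : GE × GF} (hp : ∀ us ∈ Γ₁.adjoint, ∀ vt ∈ Γ₂.adjoint,
      ⟪tmE us.2 vt.2, p.1⟫ = ⟪tmF us.1 vt.1, p.2⟫) :
    p ∈ (graphTensor tmE tmF Γ₁ Γ₂).topologicalClosure := by
  obtain ⟨q, hq, hort⟩ :=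
    (graphTensor tmE tmF Γ₁ Γ₂).exists_mem_topologicalClosure_sub_orthogonal p
  have hweak : ∀ us ∈ Γ₁.adjoint, ∀ vt ∈ Γ₂.adjoint,
      ⟪tmE us.2 vt.2, p.1 - q.1⟫ = ⟪tmF us.1 vt.1, p.2 - q.2⟫ := fun us hus vt hvt => by
    rw [inner_sub_right, inner_sub_right, hp us hus vt hvt,
      inner_tensor_adjoint_of_mem_closure htmE htmF hq hus hvt]
  obtain ⟨C₁, D₁, hC₁, h₁⟩ := Submodule.exists_resolvent hΓ₁ hdense₁
  obtain ⟨C₂, D₂, hC₂, h₂⟩ := Submodule.exists_resolvent hΓ₂ hdense₂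
  have hfst : p.1 - q.1 = 0 := by
    refine eq_zero_of_inner_resolvent_tensor htmE htmE_dense C₁ D₁ C₂ D₂ hC₁ hC₂ fun a b => ?_
    obtain ⟨-, s, hs, hs'⟩ := h₁ a
    obtain ⟨-, t, ht, ht'⟩ := h₂ b
    rw [hweak _ hs' _ ht']
    exact hort _ (Submodule.le_topologicalClosure _ (tensor_mem_graphTensor hs ht))
  have hsnd : p.2 - q.2 = 0 := by
    refine eq_zero_of_inner_tensor_eq_zero_s16 htmF htmF_dense
      (Submodule.dense_map_fst_adjoint hΓ₁ hgraph₁) (Submodule.dense_map_fst_adjoint hΓ₂ hgraph₂) ?_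
    rintro _ ⟨us, hus, rfl⟩ _ ⟨vt, hvt, rfl⟩
    have h := hweak us hus vt hvt
    rw [hfst, inner_zero_right] at h
    rw [← inner_conj_symm]
    simp [← h]
  have hpq : p = q := Prod.ext (sub_eq_zero.mp hfst) (sub_eq_zero.mp hsnd)
  exact hpq ▸ hq

end GraphTensor

section Composition

variable {E F G : Type*}
  [NormedAddCommGroup E] [InnerProductSpace ℂ E]
  [NormedAddCommGroup F] [InnerProductSpace ℂ F]
  [NormedAddCommGroup G] [InnerProductSpace ℂ G]

theorem mem_graph_pmapCompCLM {T : F →ₗ.[ℂ] G} {B : E →L[ℂ] F} {p : E × G} :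
    p ∈ (pmapCompCLM T B).graph ↔ (B p.1, p.2) ∈ T.graph := by
  rw [LinearPMap.mem_graph_iff, LinearPMap.mem_graph_iff]
  constructor
  · rintro ⟨x, hx, hxp⟩
    exact ⟨⟨B x, x.2⟩, congrArg B hx, hxp⟩
  · rintro ⟨y, hy, hyp⟩
    refine ⟨⟨p.1, show B p.1 ∈ T.domain from (show (y : F) = B p.1 from hy) ▸ y.2⟩, rfl, ?_⟩
    rw [← hyp]
    exact congrArg T (Subtype.ext hy.symm)

theorem isClosed_graph_pmapCompCLM {T : F →ₗ.[ℂ] G} (hT : T.IsClosed) (B : E →L[ℂ] F) :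
    IsClosed ((pmapCompCLM T B).graph : Set (E × G)) := by
  have h : ((pmapCompCLM T B).graph : Set (E × G)) =
      (fun p : E × G => (B p.1, p.2)) ⁻¹' (T.graph : Set (F × G)) := by
    ext p
    exact mem_graph_pmapCompCLM
  rw [h]
  exact IsClosed.preimage (by fun_prop) hT

/-- The adjoint of `T B` is contained in the closure of `B† T†`. -/
theorem adjoint_graph_pmapCompCLM_le [CompleteSpace E] [CompleteSpace F] [CompleteSpace G]
    {T : F →ₗ.[ℂ] G} (hT : T.IsClosed) (B : E →L[ℂ] F) :
    (pmapCompCLM T B).graph.adjoint ≤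
      (T.graph.adjoint.map (LinearMap.id.prodMap (B†).toLinearMap)).topologicalClosure := by
  intro us hus
  refine Submodule.mem_topologicalClosure_of_inner_eq_zero _ us fun c d hcd => ?_
  have hmem : (d, -c) ∈ (pmapCompCLM T B).graph := by
    refine mem_graph_pmapCompCLM.mpr (Submodule.mem_of_orthogonal_adjoint hT _ fun vt hvt => ?_)
    have h : ⟪vt.1, c⟫ + ⟪(B†) vt.2, d⟫ = 0 := hcd _ ⟨vt, hvt, rfl⟩
    rw [ContinuousLinearMap.adjoint_inner_left] at h
    rw [← inner_conj_symm, ← inner_conj_symm (-c), inner_neg_right,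
      eq_neg_of_add_eq_zero_right h]
  have h := (Submodule.mem_adjoint_iff _ us).mp hus d (-c) hmem
  have h' := congrArg (starRingEnd ℂ) h
  simp only [inner_neg_left, map_sub, map_neg, inner_conj_symm, map_zero] at h'
  linear_combination -h'

end Composition

theorem stmt16 {H₁ H₂ H₁' H₂' H₁'' H₂'' GA GB GC : Type*}
    [NormedAddCommGroup H₁] [InnerProductSpace ℂ H₁] [CompleteSpace H₁]
    [NormedAddCommGroup H₂] [InnerProductSpace ℂ H₂] [CompleteSpace H₂]
    [NormedAddCommGroup H₁'] [InnerProductSpace ℂ H₁'] [CompleteSpace H₁']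
    [NormedAddCommGroup H₂'] [InnerProductSpace ℂ H₂'] [CompleteSpace H₂']
    [NormedAddCommGroup H₁''] [InnerProductSpace ℂ H₁''] [CompleteSpace H₁'']
    [NormedAddCommGroup H₂''] [InnerProductSpace ℂ H₂''] [CompleteSpace H₂'']
    [NormedAddCommGroup GA] [InnerProductSpace ℂ GA] [CompleteSpace GA]
    [NormedAddCommGroup GB] [InnerProductSpace ℂ GB] [CompleteSpace GB]
    [NormedAddCommGroup GC] [InnerProductSpace ℂ GC] [CompleteSpace GC]
    -- the Hilbert space tensor products `GA = H₁ ⊗ H₂`, `GB = H₁' ⊗ H₂'`, `GC = H₁'' ⊗ H₂''`: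
    (tmA : H₁ →ₗ[ℂ] H₂ →ₗ[ℂ] GA)
    (htmA_inner : ∀ (a c : H₁) (b d : H₂), ⟪tmA a b, tmA c d⟫ = ⟪a, c⟫ * ⟪b, d⟫)
    (htmA_dense : Dense (Submodule.span ℂ {z : GA | ∃ a b, z = tmA a b} : Set GA))
    (tmB : H₁' →ₗ[ℂ] H₂' →ₗ[ℂ] GB)
    (htmB_inner : ∀ (a c : H₁') (b d : H₂'), ⟪tmB a b, tmB c d⟫ = ⟪a, c⟫ * ⟪b, d⟫)
    (htmB_dense : Dense (Submodule.span ℂ {z : GB | ∃ a b, z = tmB a b} : Set GB))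
    (tmC : H₁'' →ₗ[ℂ] H₂'' →ₗ[ℂ] GC)
    (htmC_inner : ∀ (a c : H₁'') (b d : H₂''), ⟪tmC a b, tmC c d⟫ = ⟪a, c⟫ * ⟪b, d⟫)
    (htmC_dense : Dense (Submodule.span ℂ {z : GC | ∃ a b, z = tmC a b} : Set GC))
    -- the operators:
    (T₁ : H₁' →ₗ.[ℂ] H₁'') (T₂ : H₂' →ₗ.[ℂ] H₂'')
    (h₁closed : T₁.IsClosed) (h₂closed : T₂.IsClosed)
    (h₁dense : Dense (T₁.domain : Set H₁')) (h₂dense : Dense (T₂.domain : Set H₂'))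
    (B₁ : H₁ →L[ℂ] H₁') (B₂ : H₂ →L[ℂ] H₂')
    -- `T₁B₁` and `T₂B₂` are densely defined:
    (hTB₁dense : Dense ((T₁.domain.comap (B₁ : H₁ →ₗ[ℂ] H₁')) : Set H₁))
    (hTB₂dense : Dense ((T₂.domain.comap (B₂ : H₂ →ₗ[ℂ] H₂')) : Set H₂))
    -- the bounded tensor product `B₁ ⊗ B₂`:
    (Bt : GA →L[ℂ] GB)
    (hBt : ∀ (u : H₁) (v : H₂), Bt (tmA u v) = tmB (B₁ u) (B₂ v))
    -- `Tt = T₁ ⊗ T₂`, the closure of the algebraic tensor product: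
    (Tt : GB →ₗ.[ℂ] GC)
    (hTt : Tt.graph = (Submodule.span ℂ
      {p : GB × GC | ∃ (x : T₁.domain) (y : T₂.domain),
        p = (tmB (x : H₁') (y : H₂'), tmC (T₁ x) (T₂ y))}).topologicalClosure)
    -- `TBt = (T₁B₁) ⊗ (T₂B₂)`, the closure of the algebraic tensor product:
    (TBt : GA →ₗ.[ℂ] GC)
    (hTBt : TBt.graph = (Submodule.span ℂ
      {p : GA × GC | ∃ (x : (pmapCompCLM T₁ B₁).domain) (y : (pmapCompCLM T₂ B₂).domain),
        p = (tmA (x : H₁) (y : H₂),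
             tmC ((pmapCompCLM T₁ B₁) x) ((pmapCompCLM T₂ B₂) y))}).topologicalClosure) :
    pmapCompCLM Tt Bt = TBt := by
  rw [← graphTensor_graph] at hTt hTBt
  have hTt_closed : Tt.IsClosed := by
    rw [LinearPMap.IsClosed, hTt]
    exact Submodule.isClosed_topologicalClosure _
  refine LinearPMap.eq_of_eq_graph (le_antisymm (fun p hp => ?_) ?_)
  · rw [hTBt]
    refine mem_closure_graphTensor_of_inner_tensor_adjoint htmA_inner htmA_dense htmC_inner
      htmC_dense (isClosed_graph_pmapCompCLM h₁closed B₁) (isClosed_graph_pmapCompCLM h₂closed B₂)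
      (by rwa [LinearPMap.graph_map_fst_eq_domain]) (by rwa [LinearPMap.graph_map_fst_eq_domain])
      (fun b hb => LinearPMap.graph_fst_eq_zero_snd _ hb rfl)
      (fun b hb => LinearPMap.graph_fst_eq_zero_snd _ hb rfl) fun us hus vt hvt => ?_
    refine inner_tensor_eq_of_mem_closure htmA_inner htmC_inner ?_
      us (adjoint_graph_pmapCompCLM_le h₁closed B₁ hus)
      vt (adjoint_graph_pmapCompCLM_le h₂closed B₂ hvt)
    rintro _ ⟨us, hus, rfl⟩ _ ⟨vt, hvt, rfl⟩
    have hp' : (Bt p.1, p.2) ∈ Tt.graph := mem_graph_pmapCompCLM.mp hp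
    rw [hTt] at hp'
    have h := inner_tensor_adjoint_of_mem_closure htmB_inner htmC_inner hp' hus hvt
    rw [inner_eq_of_inner_tensor_eq htmA_dense Bt
      (y := tmA ((B₁†) us.2) ((B₂†) vt.2)) fun a b => ?_] at h
    · exact h
    · rw [hBt, htmA_inner, htmB_inner, ContinuousLinearMap.adjoint_inner_left,
        ContinuousLinearMap.adjoint_inner_left]
  · rw [hTBt]
    refine Submodule.topologicalClosure_minimal _ ?_ (isClosed_graph_pmapCompCLM hTt_closed Bt)
    rw [graphTensor, Submodule.span_le]
    rintro _ ⟨k, hk, l, hl, rfl⟩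
    refine mem_graph_pmapCompCLM.mpr ?_
    rw [hBt, hTt]
    exact Submodule.le_topologicalClosure _ (tensor_mem_graphTensor
      (mem_graph_pmapCompCLM.mp hk) (mem_graph_pmapCompCLM.mp hl))
end

section
/- For i = 1, 2, let R_i be a closed linear operator from a Hilbert space H_i to a Hilbert space H_i′ and let B_i be a bounded, everywhere-defined linear operator from H_i′ to a Hilbert space H_i″. Set R := R₁ ⊗ R₂ (the closure of the algebraic tensor product, assuming it exists as a closed operator) and B := B₁ ⊗ B₂ (the bounded tensor product). If BR, B₁R₁ and B₂R₂ are all closable, then the closure of BR equals (closure of B₁R₁) ⊗ (closure of B₂R₂). In particular, if F_i is bounded, everywhere defined, and injective with bounded inverse on its range, then (F₁⊗F₂)(R₁⊗R₂) = (F₁R₁) ⊗ (F₂R₂). -/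
open scoped ComplexInnerProductSpace

section InnerTensor

variable {E F G : Type*}
  [NormedAddCommGroup E] [InnerProductSpace ℂ E]
  [NormedAddCommGroup F] [InnerProductSpace ℂ F]
  [NormedAddCommGroup G] [InnerProductSpace ℂ G]

theorem norm_bilin_of_inner_mul (tm : E →ₗ[ℂ] F →ₗ[ℂ] G)
    (h : ∀ (a c : E) (b d : F), ⟪tm a b, tm c d⟫ = ⟪a, c⟫ * ⟪b, d⟫) (a : E) (b : F) :
    ‖tm a b‖ = ‖a‖ * ‖b‖ := by
  have key : (‖tm a b‖ ^ 2 : ℂ) = ((‖a‖ * ‖b‖) ^ 2 : ℂ) := by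
    have := h a a b b
    simp only [inner_self_eq_norm_sq_to_K] at this
    rw [mul_pow]
    exact this
  have key' : ‖tm a b‖ ^ 2 = (‖a‖ * ‖b‖) ^ 2 := by exact_mod_cast key
  exact (pow_left_inj₀ (norm_nonneg _) (by positivity) two_ne_zero).1 key'

theorem continuous_bilin_of_inner_mul (tm : E →ₗ[ℂ] F →ₗ[ℂ] G)
    (h : ∀ (a c : E) (b d : F), ⟪tm a b, tm c d⟫ = ⟪a, c⟫ * ⟪b, d⟫) :
    Continuous fun p : E × F => tm p.1 p.2 :=
  (tm.mkContinuous₂ 1 fun a b => by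
    rw [norm_bilin_of_inner_mul tm h, one_mul]).continuous₂

theorem norm_sq_sum_bilin_of_inner_mul (tm : E →ₗ[ℂ] F →ₗ[ℂ] G)
    (h : ∀ (a c : E) (b d : F), ⟪tm a b, tm c d⟫ = ⟪a, c⟫ * ⟪b, d⟫)
    {ι : Type*} [Fintype ι] (a : ι → E) (b : ι → F) :
    ((‖∑ i, tm (a i) (b i)‖ ^ 2 : ℝ) : ℂ) =
      star (1 : ι → ℂ) ⬝ᵥ ((Matrix.gram ℂ a).hadamard (Matrix.gram ℂ b)).mulVec 1 := by
  have : ((‖∑ i, tm (a i) (b i)‖ ^ 2 : ℝ) : ℂ) =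
      ⟪∑ i, tm (a i) (b i), ∑ i, tm (a i) (b i)⟫ := by
    rw [inner_self_eq_norm_sq_to_K]; simp
  rw [this, sum_inner]
  simp [dotProduct, Matrix.mulVec, Matrix.hadamard_apply, Matrix.gram_apply, inner_sum, h]

end InnerTensor

open scoped ComplexOrder in
theorem posSemidef_gram_comp_sub {E F : Type*}
    [NormedAddCommGroup E] [InnerProductSpace ℂ E]
    [NormedAddCommGroup F] [InnerProductSpace ℂ F]
    (T : E →L[ℂ] F) {c : ℝ} (hc : 0 ≤ c) (hT : ∀ x, c * ‖x‖ ≤ ‖T x‖)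
    {ι : Type*} [Fintype ι] (v : ι → E) :
    (Matrix.gram ℂ (fun i => T (v i)) - (c ^ 2 : ℝ) • Matrix.gram ℂ v).PosSemidef := by
  refine .of_dotProduct_mulVec_nonneg ?_ fun x => ?_
  · refine (Matrix.isHermitian_gram _ _).sub ?_
    rw [Matrix.IsHermitian, Matrix.conjTranspose_smul, Matrix.isHermitian_gram]
    simp
  · rw [Matrix.sub_mulVec, dotProduct_sub, Matrix.smul_mulVec, dotProduct_smul,
      Matrix.star_dotProduct_gram_mulVec, Matrix.star_dotProduct_gram_mulVec]
    have hsum : ∑ i, x i • T (v i) = T (∑ i, x i • v i) := by simp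
    rw [hsum, inner_self_eq_norm_sq_to_K, inner_self_eq_norm_sq_to_K]
    have h1 := pow_le_pow_left₀ (by positivity) (hT (∑ i, x i • v i)) 2
    rw [mul_pow] at h1
    have h2 : (0 : ℂ) ≤ ((‖T (∑ i, x i • v i)‖ ^ 2 - c ^ 2 * ‖∑ i, x i • v i‖ ^ 2 : ℝ) : ℂ) :=
      Complex.zero_le_real.2 (sub_nonneg.2 h1)
    convert h2 using 1
    push_cast [Complex.real_smul]
    rfl

open scoped ComplexOrder in
/-- The tensor product of bounded below operators is bounded below. -/
theorem bounded_below_tensor {E₁ E₂ F₁ F₂ G G' : Type*}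
    [NormedAddCommGroup E₁] [InnerProductSpace ℂ E₁]
    [NormedAddCommGroup E₂] [InnerProductSpace ℂ E₂]
    [NormedAddCommGroup F₁] [InnerProductSpace ℂ F₁]
    [NormedAddCommGroup F₂] [InnerProductSpace ℂ F₂]
    [NormedAddCommGroup G] [InnerProductSpace ℂ G]
    [NormedAddCommGroup G'] [InnerProductSpace ℂ G']
    (tm : E₁ →ₗ[ℂ] E₂ →ₗ[ℂ] G)
    (htm : ∀ (a c : E₁) (b d : E₂), ⟪tm a b, tm c d⟫ = ⟪a, c⟫ * ⟪b, d⟫)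
    (htm_dense : Dense (Submodule.span ℂ {z : G | ∃ a b, z = tm a b} : Set G))
    (tm' : F₁ →ₗ[ℂ] F₂ →ₗ[ℂ] G')
    (htm' : ∀ (a c : F₁) (b d : F₂), ⟪tm' a b, tm' c d⟫ = ⟪a, c⟫ * ⟪b, d⟫)
    (T₁ : E₁ →L[ℂ] F₁) (T₂ : E₂ →L[ℂ] F₂) (T : G →L[ℂ] G')
    (hT : ∀ u v, T (tm u v) = tm' (T₁ u) (T₂ v))
    {c₁ c₂ : ℝ} (hc₁ : 0 ≤ c₁) (hc₂ : 0 ≤ c₂)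
    (h₁ : ∀ x, c₁ * ‖x‖ ≤ ‖T₁ x‖) (h₂ : ∀ x, c₂ * ‖x‖ ≤ ‖T₂ x‖) (z : G) :
    c₁ * c₂ * ‖z‖ ≤ ‖T z‖ := by
  have hclosed : IsClosed {z : G | c₁ * c₂ * ‖z‖ ≤ ‖T z‖} :=
    isClosed_le (by fun_prop) (by fun_prop)
  refine hclosed.closure_subset_iff.2 ?_ (htm_dense z)
  intro z hz
  obtain ⟨n, f, g, rfl⟩ := Submodule.mem_span_set'.1 hz
  choose a b hab using fun i => (g i).2
  have hz : ∑ i, f i • (g i : G) = ∑ i, tm (f i • a i) (b i) := by simp [hab]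
  rw [Set.mem_ofPred_eq, hz]
  have hTz : T (∑ i, tm (f i • a i) (b i)) = ∑ i, tm' (T₁ (f i • a i)) (T₂ (b i)) := by
    rw [map_sum]; simp_rw [hT]
  rw [hTz]
  set u : Fin n → E₁ := fun i => f i • a i
  refine (pow_le_pow_iff_left₀ (by positivity) (by positivity) two_ne_zero).1 ?_
  have hpos := (((posSemidef_gram_comp_sub T₁ hc₁ h₁ u).hadamard
      (Matrix.posSemidef_gram ℂ fun i => T₂ (b i))).add
      (((Matrix.posSemidef_gram ℂ u).hadamard
        (posSemidef_gram_comp_sub T₂ hc₂ h₂ b)).smul (sq_nonneg c₁))).dotProduct_mulVec_nonneg 1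
  have hmat : (Matrix.gram ℂ (fun i => T₁ (u i)) - (c₁ ^ 2 : ℝ) • Matrix.gram ℂ u).hadamard
        (Matrix.gram ℂ fun i => T₂ (b i)) +
      (c₁ ^ 2 : ℝ) • (Matrix.gram ℂ u).hadamard
        (Matrix.gram ℂ (fun i => T₂ (b i)) - (c₂ ^ 2 : ℝ) • Matrix.gram ℂ b) =
      (Matrix.gram ℂ (fun i => T₁ (u i))).hadamard (Matrix.gram ℂ fun i => T₂ (b i)) -
      ((c₁ * c₂) ^ 2 : ℝ) • (Matrix.gram ℂ u).hadamard (Matrix.gram ℂ b) := by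
    ext i j
    simp
    ring
  rw [hmat, Matrix.sub_mulVec, dotProduct_sub, Matrix.smul_mulVec, dotProduct_smul,
    ← norm_sq_sum_bilin_of_inner_mul tm' htm', ← norm_sq_sum_bilin_of_inner_mul tm htm,
    Complex.real_smul, ← Complex.ofReal_mul, ← Complex.ofReal_sub, Complex.zero_le_real] at hpos
  rw [mul_pow]
  exact sub_nonneg.1 hpos

theorem LinearMap.graph_compPMap {E F G : Type*}
    [AddCommGroup E] [Module ℂ E] [AddCommGroup F] [Module ℂ F] [AddCommGroup G] [Module ℂ G]
    (g : F →ₗ[ℂ] G) (f : E →ₗ.[ℂ] F) :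
    (g.compPMap f).graph = f.graph.map (LinearMap.id.prodMap g) := by
  ext ⟨x, y⟩
  simp only [LinearPMap.mem_graph_iff, Submodule.mem_map, Prod.exists, LinearMap.prodMap_apply,
    LinearMap.id_apply, Prod.mk.injEq]
  constructor
  · rintro ⟨w, hw, rfl⟩
    exact ⟨x, f w, ⟨w, hw, rfl⟩, rfl, rfl⟩
  · rintro ⟨_, _, ⟨w, hw, rfl⟩, rfl, rfl⟩
    exact ⟨w, hw, rfl⟩

theorem Submodule.topologicalClosure_map_topologicalClosure {E F : Type*}
    [NormedAddCommGroup E] [NormedSpace ℂ E] [NormedAddCommGroup F] [NormedSpace ℂ F]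
    (f : E →L[ℂ] F) (s : Submodule ℂ E) :
    (s.topologicalClosure.map (f : E →ₗ[ℂ] F)).topologicalClosure =
      (s.map (f : E →ₗ[ℂ] F)).topologicalClosure := by
  refine le_antisymm ?_ (Submodule.topologicalClosure_mono
    (Submodule.map_mono s.le_topologicalClosure))
  refine Submodule.topologicalClosure_minimal _ ?_ (Submodule.isClosed_topologicalClosure _)
  exact s.topologicalClosure_map f

/-- The closed graph of `B R`, where `R` is a closed tensor product of operators. -/
theorem topologicalClosure_graph_compPMap_tensor {E₁ E₂ F₁ F₂ K₁ K₂ G G' G'' : Type*}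
    [NormedAddCommGroup E₁] [NormedSpace ℂ E₁] [NormedAddCommGroup E₂] [NormedSpace ℂ E₂]
    [NormedAddCommGroup F₁] [NormedSpace ℂ F₁] [NormedAddCommGroup F₂] [NormedSpace ℂ F₂]
    [NormedAddCommGroup K₁] [NormedSpace ℂ K₁] [NormedAddCommGroup K₂] [NormedSpace ℂ K₂]
    [NormedAddCommGroup G] [NormedSpace ℂ G] [NormedAddCommGroup G'] [NormedSpace ℂ G']
    [NormedAddCommGroup G''] [NormedSpace ℂ G'']
    (tmA : E₁ →ₗ[ℂ] E₂ →ₗ[ℂ] G) (tmB : F₁ →ₗ[ℂ] F₂ →ₗ[ℂ] G') (tmC : K₁ →ₗ[ℂ] K₂ →ₗ[ℂ] G'')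
    (R₁ : E₁ →ₗ.[ℂ] F₁) (R₂ : E₂ →ₗ.[ℂ] F₂) (R : G →ₗ.[ℂ] G')
    (hR : R.graph = (Submodule.span ℂ
      {p : G × G' | ∃ (x : R₁.domain) (y : R₂.domain),
        p = (tmA (x : E₁) (y : E₂), tmB (R₁ x) (R₂ y))}).topologicalClosure)
    (B₁ : F₁ →L[ℂ] K₁) (B₂ : F₂ →L[ℂ] K₂) (B : G' →L[ℂ] G'')
    (hB : ∀ u v, B (tmB u v) = tmC (B₁ u) (B₂ v)) :
    (LinearMap.compPMap (B : G' →ₗ[ℂ] G'') R).graph.topologicalClosure =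
      (Submodule.span ℂ {p : G × G'' | ∃ (x : R₁.domain) (y : R₂.domain),
        p = (tmA (x : E₁) (y : E₂), tmC (B₁ (R₁ x)) (B₂ (R₂ y)))}).topologicalClosure := by
  rw [LinearMap.graph_compPMap, hR]
  refine (Submodule.topologicalClosure_map_topologicalClosure
    ((ContinuousLinearMap.id ℂ G).prodMap B) _).trans ?_
  rw [Submodule.map_span]
  congr 2
  ext p
  constructor
  · rintro ⟨_, ⟨x, y, rfl⟩, rfl⟩
    exact ⟨x, y, by simp [hB]⟩
  · rintro ⟨x, y, rfl⟩
    exact ⟨_, ⟨x, y, rfl⟩, by simp [hB]⟩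

/-- Passing to the closures of the factors does not change the closed tensor product. -/
theorem topologicalClosure_span_tensor_closure {E₁ E₂ K₁ K₂ G G'' : Type*}
    [NormedAddCommGroup E₁] [NormedSpace ℂ E₁] [NormedAddCommGroup E₂] [NormedSpace ℂ E₂]
    [NormedAddCommGroup K₁] [NormedSpace ℂ K₁] [NormedAddCommGroup K₂] [NormedSpace ℂ K₂]
    [NormedAddCommGroup G] [NormedSpace ℂ G] [NormedAddCommGroup G''] [NormedSpace ℂ G'']
    (tmA : E₁ →ₗ[ℂ] E₂ →ₗ[ℂ] G) (hA : Continuous fun p : E₁ × E₂ => tmA p.1 p.2)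
    (tmC : K₁ →ₗ[ℂ] K₂ →ₗ[ℂ] G'') (hC : Continuous fun p : K₁ × K₂ => tmC p.1 p.2)
    (S₁ : E₁ →ₗ.[ℂ] K₁) (S₂ : E₂ →ₗ.[ℂ] K₂) (h₁ : S₁.IsClosable) (h₂ : S₂.IsClosable) :
    (Submodule.span ℂ {p : G × G'' | ∃ (x : S₁.closure.domain) (y : S₂.closure.domain),
        p = (tmA (x : E₁) (y : E₂), tmC (S₁.closure x) (S₂.closure y))}).topologicalClosure =
      (Submodule.span ℂ {p : G × G'' | ∃ (x : S₁.domain) (y : S₂.domain),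
        p = (tmA (x : E₁) (y : E₂), tmC (S₁ x) (S₂ y))}).topologicalClosure := by
  refine le_antisymm (Submodule.topologicalClosure_minimal _ (Submodule.span_le.2 ?_)
    (Submodule.isClosed_topologicalClosure _))
    (Submodule.topologicalClosure_mono (Submodule.span_mono ?_))
  · rintro _ ⟨x, y, rfl⟩
    have hx : ((x : E₁), S₁.closure x) ∈ closure (S₁.graph : Set (E₁ × K₁)) := by
      rw [← Submodule.topologicalClosure_coe, h₁.graph_closure_eq_closure_graph]
      exact S₁.closure.mem_graph x
    have hy : ((y : E₂), S₂.closure y) ∈ closure (S₂.graph : Set (E₂ × K₂)) := by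
      rw [← Submodule.topologicalClosure_coe, h₂.graph_closure_eq_closure_graph]
      exact S₂.closure.mem_graph y
    have hcont : Continuous fun q : (E₁ × K₁) × (E₂ × K₂) =>
        (tmA q.1.1 q.2.1, tmC q.1.2 q.2.2) :=
      (hA.comp (f := fun q : (E₁ × K₁) × (E₂ × K₂) => (q.1.1, q.2.1)) (by fun_prop)).prodMk
        (hC.comp (f := fun q : (E₁ × K₁) × (E₂ × K₂) => (q.1.2, q.2.2)) (by fun_prop))
    refine map_mem_closure hcont
      (x := (((x : E₁), S₁.closure x), ((y : E₂), S₂.closure y)))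
      (s := (S₁.graph : Set (E₁ × K₁)) ×ˢ (S₂.graph : Set (E₂ × K₂)))
      (by rw [closure_prod_eq]; exact ⟨hx, hy⟩) ?_
    rintro ⟨⟨_, _⟩, ⟨_, _⟩⟩ ⟨hp, hq⟩
    obtain ⟨a, rfl, rfl⟩ := (LinearPMap.mem_graph_iff _).1 hp
    obtain ⟨b, rfl, rfl⟩ := (LinearPMap.mem_graph_iff _).1 hq
    exact Submodule.subset_span ⟨a, b, rfl⟩
  · rintro _ ⟨x, y, rfl⟩
    have hle₁ := S₁.le_closure
    have hle₂ := S₂.le_closure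
    refine ⟨⟨x, hle₁.1 x.2⟩, ⟨y, hle₂.1 y.2⟩, ?_⟩
    rw [hle₁.2 (x := x) (y := ⟨x, hle₁.1 x.2⟩) rfl, hle₂.2 (x := y) (y := ⟨y, hle₂.1 y.2⟩) rfl]

theorem isClosed_compPMap_of_bounded_below {E F G : Type*}
    [NormedAddCommGroup E] [NormedSpace ℂ E]
    [NormedAddCommGroup F] [NormedSpace ℂ F] [CompleteSpace F]
    [NormedAddCommGroup G] [NormedSpace ℂ G]
    (T : F →L[ℂ] G) {c : ℝ} (hc : 0 < c) (hT : ∀ x, c * ‖x‖ ≤ ‖T x‖)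
    {R : E →ₗ.[ℂ] F} (hR : R.IsClosed) :
    (LinearMap.compPMap (T : F →ₗ[ℂ] G) R).IsClosed := by
  have hanti : AntilipschitzWith (NNReal.mk c⁻¹ (by positivity)) T := by
    refine T.antilipschitz_of_bound fun x => ?_
    rw [NNReal.coe_mk, inv_mul_eq_div, le_div_iff₀ hc, mul_comm]
    exact hT x
  have hemb : Topology.IsClosedEmbedding (Prod.map (id : E → E) T) :=
    Topology.IsClosedEmbedding.id.prodMap (hanti.isClosedEmbedding T.uniformContinuous)
  rw [LinearPMap.IsClosed, LinearMap.graph_compPMap]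
  exact hemb.isClosedMap _ hR

/-!
STATEMENT 17.  For `i = 1, 2` let `Rᵢ` be a closed operator from `Hᵢ` to `Hᵢ'` and
`Bᵢ : Hᵢ' →L Hᵢ''` bounded and everywhere defined.  Set `R := R₁ ⊗ R₂` (the closure of the
algebraic tensor product, assumed to exist as a closed operator, i.e. hypothesised as an
operator whose graph is the closure of the span of the elementary pairs) and `B := B₁ ⊗ B₂`.
If `BR`, `B₁R₁` and `B₂R₂` are all closable then `closure (BR) = (closure B₁R₁) ⊗ (closure B₂R₂)`.
In particular, if `Fᵢ` is bounded, everywhere defined and injective with bounded inverse on its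
range (i.e. bounded below), then `(F₁ ⊗ F₂)(R₁ ⊗ R₂) = (F₁R₁) ⊗ (F₂R₂)`.
-/
theorem stmt17 {H₁ H₂ H₁' H₂' H₁'' H₂'' GA GB GC : Type*}
    [NormedAddCommGroup H₁] [InnerProductSpace ℂ H₁] [CompleteSpace H₁]
    [NormedAddCommGroup H₂] [InnerProductSpace ℂ H₂] [CompleteSpace H₂]
    [NormedAddCommGroup H₁'] [InnerProductSpace ℂ H₁'] [CompleteSpace H₁']
    [NormedAddCommGroup H₂'] [InnerProductSpace ℂ H₂'] [CompleteSpace H₂']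
    [NormedAddCommGroup H₁''] [InnerProductSpace ℂ H₁''] [CompleteSpace H₁'']
    [NormedAddCommGroup H₂''] [InnerProductSpace ℂ H₂''] [CompleteSpace H₂'']
    [NormedAddCommGroup GA] [InnerProductSpace ℂ GA] [CompleteSpace GA]
    [NormedAddCommGroup GB] [InnerProductSpace ℂ GB] [CompleteSpace GB]
    [NormedAddCommGroup GC] [InnerProductSpace ℂ GC] [CompleteSpace GC]
    (tmA : H₁ →ₗ[ℂ] H₂ →ₗ[ℂ] GA)
    (htmA_inner : ∀ (a c : H₁) (b d : H₂), ⟪tmA a b, tmA c d⟫ = ⟪a, c⟫ * ⟪b, d⟫)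
    (htmA_dense : Dense (Submodule.span ℂ {z : GA | ∃ a b, z = tmA a b} : Set GA))
    (tmB : H₁' →ₗ[ℂ] H₂' →ₗ[ℂ] GB)
    (htmB_inner : ∀ (a c : H₁') (b d : H₂'), ⟪tmB a b, tmB c d⟫ = ⟪a, c⟫ * ⟪b, d⟫)
    (htmB_dense : Dense (Submodule.span ℂ {z : GB | ∃ a b, z = tmB a b} : Set GB))
    (tmC : H₁'' →ₗ[ℂ] H₂'' →ₗ[ℂ] GC)
    (htmC_inner : ∀ (a c : H₁'') (b d : H₂''), ⟪tmC a b, tmC c d⟫ = ⟪a, c⟫ * ⟪b, d⟫)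
    (htmC_dense : Dense (Submodule.span ℂ {z : GC | ∃ a b, z = tmC a b} : Set GC))
    (R₁ : H₁ →ₗ.[ℂ] H₁') (R₂ : H₂ →ₗ.[ℂ] H₂')
    (h₁closed : R₁.IsClosed) (h₂closed : R₂.IsClosed)
    -- `R = R₁ ⊗ R₂`, the closure of the algebraic tensor product, assumed to be a
    -- (necessarily closed) operator:
    (R : GA →ₗ.[ℂ] GB)
    (hR : R.graph = (Submodule.span ℂ
      {p : GA × GB | ∃ (x : R₁.domain) (y : R₂.domain),
        p = (tmA (x : H₁) (y : H₂), tmB (R₁ x) (R₂ y))}).topologicalClosure) :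
    -- main statement:
    (∀ (B₁ : H₁' →L[ℂ] H₁'') (B₂ : H₂' →L[ℂ] H₂'') (Bt : GB →L[ℂ] GC),
      (∀ (u : H₁') (v : H₂'), Bt (tmB u v) = tmC (B₁ u) (B₂ v)) →
      (LinearMap.compPMap (Bt : GB →ₗ[ℂ] GC) R).IsClosable →
      (LinearMap.compPMap (B₁ : H₁' →ₗ[ℂ] H₁'') R₁).IsClosable →
      (LinearMap.compPMap (B₂ : H₂' →ₗ[ℂ] H₂'') R₂).IsClosable →
      ∀ S : GA →ₗ.[ℂ] GC,
        S.graph = (Submodule.span ℂ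
          {p : GA × GC |
            ∃ (x : (LinearMap.compPMap (B₁ : H₁' →ₗ[ℂ] H₁'') R₁).closure.domain)
              (y : (LinearMap.compPMap (B₂ : H₂' →ₗ[ℂ] H₂'') R₂).closure.domain),
            p = (tmA (x : H₁) (y : H₂),
                 tmC ((LinearMap.compPMap (B₁ : H₁' →ₗ[ℂ] H₁'') R₁).closure x)
                     ((LinearMap.compPMap (B₂ : H₂' →ₗ[ℂ] H₂'') R₂).closure y))}).topologicalClosure →
        (LinearMap.compPMap (Bt : GB →ₗ[ℂ] GC) R).closure = S) ∧
    -- the particular case of bounded-below `F₁`, `F₂`: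
    (∀ (F₁ : H₁' →L[ℂ] H₁'') (F₂ : H₂' →L[ℂ] H₂''),
      (∃ c > (0:ℝ), ∀ x : H₁', c * ‖x‖ ≤ ‖F₁ x‖) →
      (∃ c > (0:ℝ), ∀ x : H₂', c * ‖x‖ ≤ ‖F₂ x‖) →
      ∀ Ft : GB →L[ℂ] GC,
        (∀ (u : H₁') (v : H₂'), Ft (tmB u v) = tmC (F₁ u) (F₂ v)) →
        ∀ S : GA →ₗ.[ℂ] GC,
          S.graph = (Submodule.span ℂ
            {p : GA × GC | ∃ (x : R₁.domain) (y : R₂.domain),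
              p = (tmA (x : H₁) (y : H₂), tmC (F₁ (R₁ x)) (F₂ (R₂ y)))}).topologicalClosure →
          LinearMap.compPMap (Ft : GB →ₗ[ℂ] GC) R = S) := by
  refine ⟨fun B₁ B₂ Bt hBt hcl hcl₁ hcl₂ S hS => ?_, fun F₁ F₂ hF₁ hF₂ Ft hFt S hS => ?_⟩
  · refine LinearPMap.eq_of_eq_graph ?_
    rw [← hcl.graph_closure_eq_closure_graph, hS,
      topologicalClosure_graph_compPMap_tensor tmA tmB tmC R₁ R₂ R hR B₁ B₂ Bt hBt,
      topologicalClosure_span_tensor_closure tmA (continuous_bilin_of_inner_mul tmA htmA_inner)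
        tmC (continuous_bilin_of_inner_mul tmC htmC_inner) _ _ hcl₁ hcl₂]
    rfl
  · obtain ⟨c₁, hc₁, h₁⟩ := hF₁
    obtain ⟨c₂, hc₂, h₂⟩ := hF₂
    have hRcl : R.IsClosed := by
      rw [LinearPMap.IsClosed, hR]
      exact Submodule.isClosed_topologicalClosure _
    have hcl := isClosed_compPMap_of_bounded_below Ft (mul_pos hc₁ hc₂)
      (bounded_below_tensor tmB htmB_inner htmB_dense tmC htmC_inner F₁ F₂ Ft hFt
        hc₁.le hc₂.le h₁ h₂) hRcl
    refine LinearPMap.eq_of_eq_graph ?_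
    rw [hS, ← topologicalClosure_graph_compPMap_tensor tmA tmB tmC R₁ R₂ R hR F₁ F₂ Ft hFt]
    exact hcl.submodule_topologicalClosure_eq.symm
end

section
/- For i = 1, 2, let T_i be a closed, densely defined linear operator in a complex Hilbert space 𝔥_i and let U_i be a closed subspace of 𝔥_i such that T_i(U_i ∩ Dom T_i) ⊆ U_i. Let T := T₁ ⊗ T₂ (the closure of the algebraic tensor product operator in 𝔥₁ ⊗ 𝔥₂) and let U := U₁ ⊗ U₂ denote the closure of the algebraic tensor product U₁ ⊗̲ U₂ in 𝔥₁ ⊗ 𝔥₂. Then T(U ∩ Dom T) ⊆ U. -/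
open scoped ComplexInnerProductSpace

section TensorSlice

open Submodule ContinuousLinearMap

/-- The adjoint of a closed densely defined operator between Hilbert spaces is densely defined. -/
theorem LinearPMap.IsClosed.dense_adjoint_domain {E F : Type*}
    [NormedAddCommGroup E] [InnerProductSpace ℂ E] [CompleteSpace E]
    [NormedAddCommGroup F] [InnerProductSpace ℂ F] [CompleteSpace F]
    {T : E →ₗ.[ℂ] F} (hT : T.IsClosed) : Dense (T.adjoint.domain : Set F) := by
  rw [dense_iff_topologicalClosure_eq_top, topologicalClosure_eq_top_iff, eq_bot_iff]
  intro w hw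
  let e := WithLp.prodContinuousLinearEquiv 2 ℂ E F
  let Γ : Submodule ℂ (WithLp 2 (E × F)) := T.graph.comap (e : WithLp 2 (E × F) →ₗ[ℂ] E × F)
  have hΓ : _root_.IsClosed (Γ : Set (WithLp 2 (E × F))) := hT.preimage e.continuous
  have : CompleteSpace Γ := hΓ.completeSpace_coe
  have h : WithLp.toLp 2 ((0 : E), w) ∈ Γ := by
    rw [← orthogonal_orthogonal Γ, mem_orthogonal]
    intro p hp
    have hdom : p.snd ∈ T.adjoint.domain := by
      refine T.mem_adjoint_domain_of_exists _ ⟨-p.fst, fun x ↦ ?_⟩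
      have h := (mem_orthogonal' _ _).1 hp (WithLp.toLp 2 ((x : E), T x)) (T.mem_graph x)
      rw [WithLp.prod_inner_apply] at h
      rw [inner_neg_left]
      exact neg_eq_of_add_eq_zero_right h
    rw [WithLp.prod_inner_apply]
    simpa using (mem_orthogonal _ _).1 hw _ hdom
  exact T.graph_fst_eq_zero_snd (x := 0) (x' := w) h rfl

variable {h₁ h₂ G : Type*}
  [NormedAddCommGroup h₁] [InnerProductSpace ℂ h₁]
  [NormedAddCommGroup h₂] [InnerProductSpace ℂ h₂]
  [NormedAddCommGroup G] [InnerProductSpace ℂ G]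
  {tm : h₁ →ₗ[ℂ] h₂ →ₗ[ℂ] G}

theorem norm_tensor (htm : ∀ (a c : h₁) (b d : h₂), ⟪tm a b, tm c d⟫ = ⟪a, c⟫ * ⟪b, d⟫)
    (a : h₁) (b : h₂) : ‖tm a b‖ = ‖a‖ * ‖b‖ := by
  have h := htm a a b b
  simp only [inner_self_eq_norm_sq_to_K] at h
  rw [← mul_pow] at h
  have h' : ‖tm a b‖ ^ 2 = (‖a‖ * ‖b‖) ^ 2 := by exact_mod_cast h
  exact (sq_eq_sq₀ (by positivity) (by positivity)).1 h'

variable [CompleteSpace h₁] [CompleteSpace G]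

/-- The partial inner product against `w` in the second factor: there is a bounded operator
`a ⊗ b ↦ ⟪w, b⟫ • a`, adjoint to `c ↦ c ⊗ w`. -/
theorem exists_tensor_slice
    (htm : ∀ (a c : h₁) (b d : h₂), ⟪tm a b, tm c d⟫ = ⟪a, c⟫ * ⟪b, d⟫) (w : h₂) :
    ∃ S : G →L[ℂ] h₁, (∀ a b, S (tm a b) = ⟪w, b⟫ • a) ∧ ∀ c y, ⟪c, S y⟫ = ⟪tm c w, y⟫ := by
  let R : h₁ →L[ℂ] G := (tm.flip w).mkContinuous ‖w‖ fun a ↦ by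
    rw [LinearMap.flip_apply, norm_tensor htm, mul_comm]
  have hR (c : h₁) : R c = tm c w := rfl
  refine ⟨adjoint R, fun a b ↦ ext_inner_left ℂ fun c ↦ ?_, fun c y ↦ ?_⟩
  · rw [adjoint_inner_right, hR, htm, inner_smul_right, mul_comm]
  · rw [adjoint_inner_right, hR]

variable [CompleteSpace h₂]

/-- If `U₁` is invariant under `T₁`, then `T₁ ⊗ T₂` maps `U₁ ⊗ h₂` into the orthogonal complement
of `U₁ᗮ ⊗ h₂`. -/
theorem inner_tensor_eq_zero_of_mem_closure_graph
    (htm : ∀ (a c : h₁) (b d : h₂), ⟪tm a b, tm c d⟫ = ⟪a, c⟫ * ⟪b, d⟫)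
    {T₁ : h₁ →ₗ.[ℂ] h₁} {T₂ : h₂ →ₗ.[ℂ] h₂} (hT₁ : T₁.IsClosed) (hT₂ : T₂.IsClosed)
    (hd₂ : Dense (T₂.domain : Set h₂)) {U₁ : Submodule ℂ h₁} (hU₁ : IsClosed (U₁ : Set h₁))
    (hinv : ∀ x : T₁.domain, (x : h₁) ∈ U₁ → T₁ x ∈ U₁) {z y : G}
    (hzy : (z, y) ∈ (span ℂ {p : G × G | ∃ (x : T₁.domain) (y : T₂.domain),
      p = (tm (x : h₁) (y : h₂), tm (T₁ x) (T₂ y))}).topologicalClosure)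
    (hz : z ∈ (span ℂ {w : G | ∃ u ∈ U₁, ∃ b, w = tm u b}).topologicalClosure)
    {v : h₁} (hv : v ∈ U₁ᗮ) (b : h₂) : ⟪tm v b, y⟫ = 0 := by
  have key : ∀ w ∈ T₂.adjoint.domain, ⟪tm v w, y⟫ = 0 := by
    intro w hw
    obtain ⟨S, hS, hS'⟩ := exists_tensor_slice htm w
    obtain ⟨S₀, hS₀, -⟩ := exists_tensor_slice htm (T₂.adjoint ⟨w, hw⟩)
    have hgraph : (S₀ z, S y) ∈ T₁.graph := by
      let L : G × G →L[ℂ] h₁ × h₁ := S₀.prodMap S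
      have hle := topologicalClosure_minimal (t := T₁.graph.comap (L : G × G →ₗ[ℂ] h₁ × h₁))
        (span ℂ {p : G × G | ∃ (x : T₁.domain) (y : T₂.domain),
          p = (tm (x : h₁) (y : h₂), tm (T₁ x) (T₂ y))})
        (span_le.2 ?_) (hT₁.preimage L.continuous)
      · exact hle hzy
      · rintro _ ⟨x, y, rfl⟩
        have hadj : ⟪T₂.adjoint ⟨w, hw⟩, (y : h₂)⟫ = ⟪w, T₂ y⟫ :=
          LinearPMap.adjoint_isFormalAdjoint hd₂ ⟨w, hw⟩ y
        change (S₀ (tm x y), S (tm (T₁ x) (T₂ y))) ∈ T₁.graph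
        rw [hS, hS₀, hadj]
        exact T₁.graph.smul_mem _ (T₁.mem_graph x)
    have hmem : S₀ z ∈ U₁ := by
      have hle := topologicalClosure_minimal (t := U₁.comap (S₀ : G →ₗ[ℂ] h₁))
        (span ℂ {w : G | ∃ u ∈ U₁, ∃ b, w = tm u b})
        (span_le.2 ?_) (hU₁.preimage S₀.continuous)
      · exact hle hz
      · rintro _ ⟨u, hu, b, rfl⟩
        change S₀ (tm u b) ∈ U₁
        rw [hS₀]
        exact U₁.smul_mem _ hu
    obtain ⟨x, hx, hx'⟩ := T₁.mem_graph_iff.1 hgraph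
    rw [← hS', ← show T₁ x = S y from hx']
    exact (mem_orthogonal' _ _).1 hv _ (hinv x (hx ▸ hmem))
  obtain ⟨S, -, hS'⟩ := exists_tensor_slice (tm := tm.flip)
    (fun a c b d ↦ by simp only [LinearMap.flip_apply, htm, mul_comm]) v
  have hSy (w : h₂) : ⟪w, S y⟫ = ⟪tm v w, y⟫ := hS' w y
  have h0 : S y = 0 :=
    hT₂.dense_adjoint_domain.eq_zero_of_inner_right ℂ fun w hw ↦ (hSy w).trans (key w hw)
  rw [← hSy, h0, inner_zero_right]

/-- A vector orthogonal to `U₁ᗮ ⊗ h₂` and to `h₁ ⊗ U₂ᗮ` lies in `U₁ ⊗ U₂`. -/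
theorem mem_closure_span_tensor
    (htm : ∀ (a c : h₁) (b d : h₂), ⟪tm a b, tm c d⟫ = ⟪a, c⟫ * ⟪b, d⟫)
    (hdense : Dense (span ℂ {z : G | ∃ a b, z = tm a b} : Set G))
    {U₁ : Submodule ℂ h₁} {U₂ : Submodule ℂ h₂}
    (hU₁ : IsClosed (U₁ : Set h₁)) (hU₂ : IsClosed (U₂ : Set h₂)) {y : G}
    (hy₁ : ∀ v ∈ U₁ᗮ, ∀ b, ⟪tm v b, y⟫ = 0) (hy₂ : ∀ a, ∀ v ∈ U₂ᗮ, ⟪tm a v, y⟫ = 0) :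
    y ∈ (span ℂ {w : G | ∃ u₁ ∈ U₁, ∃ u₂ ∈ U₂, w = tm u₁ u₂}).topologicalClosure := by
  have : CompleteSpace U₁ := hU₁.completeSpace_coe
  have : CompleteSpace U₂ := hU₂.completeSpace_coe
  set U := (span ℂ {w : G | ∃ u₁ ∈ U₁, ∃ u₂ ∈ U₂, w = tm u₁ u₂}).topologicalClosure
  have : CompleteSpace U := (isClosed_topologicalClosure _).completeSpace_coe
  have hmem {a b} (ha : a ∈ U₁) (hb : b ∈ U₂) : tm a b ∈ U :=
    le_topologicalClosure _ (subset_span ⟨a, ha, b, hb, rfl⟩)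
  have horth {g : G} (hg : ∀ a ∈ U₁, ∀ b ∈ U₂, ⟪g, tm a b⟫ = 0) : ∀ p ∈ U, ⟪g, p⟫ = 0 := by
    have hle := topologicalClosure_minimal (t := (ℂ ∙ g)ᗮ)
      (span ℂ {w : G | ∃ u₁ ∈ U₁, ∃ u₂ ∈ U₂, w = tm u₁ u₂}) (span_le.2 ?_)
      (isClosed_orthogonal _)
    · exact fun p hp ↦ mem_orthogonal_singleton_iff_inner_right.1 (hle hp)
    · rintro _ ⟨a, ha, b, hb, rfl⟩
      exact mem_orthogonal_singleton_iff_inner_right.2 (hg a ha b hb)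
  obtain ⟨p, hp, q, hq, rfl⟩ := U.exists_add_mem_mem_orthogonal y
  have hq₁ : ∀ v ∈ U₁ᗮ, ∀ b, ⟪tm v b, q⟫ = 0 := fun v hv b ↦ by
    have h := hy₁ v hv b
    rwa [inner_add_right, horth (fun a ha d _ ↦ ?_) p hp, zero_add] at h
    rw [htm, (mem_orthogonal' _ _).1 hv a ha, zero_mul]
  have hq₂ : ∀ a, ∀ v ∈ U₂ᗮ, ⟪tm a v, q⟫ = 0 := fun a v hv ↦ by
    have h := hy₂ a v hv
    rwa [inner_add_right, horth (fun c _ d hd ↦ ?_) p hp, zero_add] at h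
    rw [htm, (mem_orthogonal' _ _).1 hv d hd, mul_zero]
  have hq_tensor (a : h₁) (b : h₂) : ⟪tm a b, q⟫ = 0 := by
    obtain ⟨a, ha, a', ha', rfl⟩ := U₁.exists_add_mem_mem_orthogonal a
    obtain ⟨b', hb', b'', hb'', rfl⟩ := U₂.exists_add_mem_mem_orthogonal b
    rw [map_add tm, LinearMap.add_apply, inner_add_left, hq₁ a' ha', map_add, inner_add_left,
      hq₂ a b'' hb'', (mem_orthogonal _ _).1 hq _ (hmem ha hb'), add_zero, add_zero]
  have hq0 : q = 0 := hdense.eq_zero_of_inner_right ℂ fun g hg ↦ by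
    have hle : span ℂ {z : G | ∃ a b, z = tm a b} ≤ (ℂ ∙ q)ᗮ := by
      rw [span_le]
      rintro _ ⟨a, b, rfl⟩
      exact mem_orthogonal_singleton_iff_inner_left.2 (hq_tensor a b)
    exact mem_orthogonal_singleton_iff_inner_left.1 (hle hg)
  rwa [hq0, add_zero]

end TensorSlice

/-!
STATEMENT 19.  For `i = 1, 2` let `Tᵢ` be a closed densely defined operator in a complex
Hilbert space `𝔥ᵢ` and `Uᵢ` a closed subspace with `Tᵢ(Uᵢ ∩ Dom Tᵢ) ⊆ Uᵢ`.  Let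
`T := T₁ ⊗ T₂` (the closure of the algebraic tensor product operator on `𝔥₁ ⊗ 𝔥₂`, realised
abstractly as `G`) and `U := U₁ ⊗ U₂` (the closed subspace generated by the elementary tensors
`u₁ ⊗ u₂`, `uᵢ ∈ Uᵢ`).  Then `T(U ∩ Dom T) ⊆ U`.
-/
theorem stmt19 {h₁ h₂ G : Type*}
    [NormedAddCommGroup h₁] [InnerProductSpace ℂ h₁] [CompleteSpace h₁]
    [NormedAddCommGroup h₂] [InnerProductSpace ℂ h₂] [CompleteSpace h₂]
    [NormedAddCommGroup G] [InnerProductSpace ℂ G] [CompleteSpace G]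
    (tm : h₁ →ₗ[ℂ] h₂ →ₗ[ℂ] G)
    (htm_inner : ∀ (a c : h₁) (b d : h₂), ⟪tm a b, tm c d⟫ = ⟪a, c⟫ * ⟪b, d⟫)
    (htm_dense : Dense (Submodule.span ℂ {z : G | ∃ a b, z = tm a b} : Set G))
    (T₁ : h₁ →ₗ.[ℂ] h₁) (T₂ : h₂ →ₗ.[ℂ] h₂)
    (h₁closed : T₁.IsClosed) (h₂closed : T₂.IsClosed)
    (h₁dense : Dense (T₁.domain : Set h₁)) (h₂dense : Dense (T₂.domain : Set h₂))
    (U₁ : Submodule ℂ h₁) (U₂ : Submodule ℂ h₂)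
    (hU₁closed : IsClosed (U₁ : Set h₁)) (hU₂closed : IsClosed (U₂ : Set h₂))
    (hU₁inv : ∀ (x : T₁.domain), (x : h₁) ∈ U₁ → T₁ x ∈ U₁)
    (hU₂inv : ∀ (y : T₂.domain), (y : h₂) ∈ U₂ → T₂ y ∈ U₂)
    -- `T = T₁ ⊗ T₂`, the closure of the algebraic tensor product operator:
    (T : G →ₗ.[ℂ] G)
    (hT : T.graph = (Submodule.span ℂ
      {p : G × G | ∃ (x : T₁.domain) (y : T₂.domain),
        p = (tm (x : h₁) (y : h₂), tm (T₁ x) (T₂ y))}).topologicalClosure) :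
    -- `T (U ∩ Dom T) ⊆ U` where `U = U₁ ⊗ U₂`:
    ∀ (z : T.domain),
      (z : G) ∈ (Submodule.span ℂ
        {w : G | ∃ u₁ ∈ U₁, ∃ u₂ ∈ U₂, w = tm u₁ u₂}).topologicalClosure →
      T z ∈ (Submodule.span ℂ
        {w : G | ∃ u₁ ∈ U₁, ∃ u₂ ∈ U₂, w = tm u₁ u₂}).topologicalClosure := by
  intro z hz
  have hzT : ((z : G), T z) ∈ (Submodule.span ℂ
      {p : G × G | ∃ (x : T₁.domain) (y : T₂.domain),
        p = (tm (x : h₁) (y : h₂), tm (T₁ x) (T₂ y))}).topologicalClosure :=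
    hT ▸ T.mem_graph z
  refine mem_closure_span_tensor htm_inner htm_dense hU₁closed hU₂closed (fun v hv b ↦ ?_)
    fun a v hv ↦ ?_
  · refine inner_tensor_eq_zero_of_mem_closure_graph htm_inner h₁closed h₂closed h₂dense hU₁closed
      hU₁inv hzT (Submodule.topologicalClosure_mono (Submodule.span_mono ?_) hz) hv b
    rintro _ ⟨u₁, hu₁, u₂, -, rfl⟩
    exact ⟨u₁, hu₁, u₂, rfl⟩
  · refine inner_tensor_eq_zero_of_mem_closure_graph (tm := tm.flip)
      (fun a c b d ↦ by simp only [LinearMap.flip_apply, htm_inner, mul_comm])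
      h₂closed h₁closed h₁dense hU₂closed hU₂inv (z := z)
      (Submodule.topologicalClosure_mono (Submodule.span_mono ?_) hzT)
      (Submodule.topologicalClosure_mono (Submodule.span_mono ?_) hz) hv a
    · rintro _ ⟨x, y, rfl⟩
      exact ⟨y, x, rfl⟩
    · rintro _ ⟨u₁, -, u₂, hu₂, rfl⟩
      exact ⟨u₂, hu₂, u₁, rfl⟩
end
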